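/- Let G be a finite normal-form game with N ≥ 2 players, and set κ = Σ_n |S_n|, d = N−1, Z = (2d+6)(2d+5)^{κ−1}, D = 5(κ(2d+4)+2)·Z, ℒ = d·(6d−3)^{2κ−1}, ℓ = 2d(ZD)^2(1+Z) and K = ℒ·2d(ZD)^2(1+Z). Then a mixed-strategy profile σ ∈ Σ is a perfect equilibrium of G if and only if there exists an LPS profile ϱ of order K over S such that: (1) ϱ has full support and ℓ(ϱ) ≤ ℓ; (2) ϱ_n^0 = σ_n for each player n; (3) σ_n is a best reply of order K against ϱ for each player n. -/

import Mathlib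

namespace GamePE

variable {N : ℕ}

/-- A (not necessarily mixed) strategy profile. -/
abbrev Profile (S : Fin N → Type) := ∀ n, S n → ℝ

/-- τ is a profile of mixed strategies. -/
def IsMixed {S : Fin N → Type} [∀ n, Fintype (S n)] (τ : Profile S) : Prop :=
  ∀ n, (∀ s, 0 ≤ τ n s) ∧ (∑ s, τ n s) = 1

/-- τ is completely mixed. -/
def CompletelyMixed {S : Fin N → Type} (τ : Profile S) : Prop := ∀ n s, 0 < τ n s

/-- The pure strategy sn viewed as a mixed strategy. -/
def pureStrat {S : Fin N → Type} [∀ n, DecidableEq (S n)] {n : Fin N} (sn : S n) : S n → ℝ :=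
  fun s => if s = sn then 1 else 0

/-- The multilinear extension of player n's payoff. -/
noncomputable def payoff {S : Fin N → Type} [∀ n, Fintype (S n)]
    (G : Fin N → (∀ m, S m) → ℝ) (n : Fin N) (τ : Profile S) : ℝ :=
  ∑ s : ∀ m, S m, (∏ m, τ m (s m)) * G n s

/-- σ is a perfect equilibrium of the game G. -/
noncomputable def IsPerfect {S : Fin N → Type} [∀ n, Fintype (S n)] [∀ n, DecidableEq (S n)]
    (G : Fin N → (∀ m, S m) → ℝ) (σ : Profile S) : Prop :=
  ∃ σk : ℕ → Profile S,
    (∀ k, IsMixed (σk k) ∧ CompletelyMixed (σk k)) ∧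
    Filter.Tendsto σk Filter.atTop (nhds σ) ∧
    (∀ (k : ℕ) (n : Fin N) (sn : S n),
      payoff G n (Function.update (σk k) n (σ n)) ≥
        payoff G n (Function.update (σk k) n (pureStrat sn)))

/-- ϱ is an LPS profile of order K : each level of each player is a probability distribution. -/
def IsLPSProfile {S : Fin N → Type} [∀ n, Fintype (S n)] {K : ℕ}
    (ϱ : ∀ n, Fin (K+1) → S n → ℝ) : Prop :=
  ∀ n k, (∀ s, 0 ≤ ϱ n k s) ∧ (∑ s, ϱ n k s) = 1

/-- Full support for an LPS profile. -/
def FullSupport {S : Fin N → Type} {K : ℕ} (ϱ : ∀ n, Fin (K+1) → S n → ℝ) : Prop :=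
  ∀ n, ∀ s : S n, ∃ k, ϱ n k s ≠ 0

/-- ℓ(ϱ) : the max over the players of the first level at which the union of supports is everything. -/
noncomputable def lpsLevel {S : Fin N → Type} [∀ n, Fintype (S n)] {K : ℕ}
    (ϱ : ∀ n, Fin (K+1) → S n → ℝ) : ℕ :=
  Finset.univ.sup fun n =>
    sInf {k : ℕ | ∀ s : S n, ∃ i : Fin (K+1), (i : ℕ) ≤ k ∧ ϱ n i s ≠ 0}

/-- Combine a pure strategy of player n with a pure strategy profile of the others. -/
def combine {S : Fin N → Type} (n : Fin N) (sn : S n)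
    (so : ∀ m : {m : Fin N // m ≠ n}, S m.val) : ∀ m, S m :=
  fun m => if h : m = n then cast (congrArg S h.symm) sn else so ⟨m, h⟩

/-- Unnormalized induced beliefs of player n at level k. -/
noncomputable def ubelief {S : Fin N → Type} [∀ n, Fintype (S n)] {K : ℕ}
    (ϱ : ∀ n, Fin (K+1) → S n → ℝ) (n : Fin N) (k : ℕ)
    (so : ∀ m : {m : Fin N // m ≠ n}, S m.val) : ℝ :=
  ∑ kv ∈ Finset.univ.filter
      (fun kv : {m : Fin N // m ≠ n} → Fin (K+1) => (∑ m, ((kv m : ℕ))) = k),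
    ∏ m : {m : Fin N // m ≠ n}, ϱ m.val (kv m) (so m)

/-- Induced beliefs μ_n^k of player n at level k (normalized). -/
noncomputable def belief {S : Fin N → Type} [∀ n, Fintype (S n)] {K : ℕ}
    (ϱ : ∀ n, Fin (K+1) → S n → ℝ) (n : Fin N) (k : ℕ)
    (so : ∀ m : {m : Fin N // m ≠ n}, S m.val) : ℝ :=
  (∑ so' : ∀ m : {m : Fin N // m ≠ n}, S m.val, ubelief ϱ n k so')⁻¹ * ubelief ϱ n k so

/-- Expected payoff of player n playing τn against a belief μ over the opponents' profiles. -/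
noncomputable def beliefPayoff {S : Fin N → Type} [∀ n, Fintype (S n)]
    (G : Fin N → (∀ m, S m) → ℝ) (n : Fin N) (τn : S n → ℝ)
    (μ : (∀ m : {m : Fin N // m ≠ n}, S m.val) → ℝ) : ℝ :=
  ∑ so : ∀ m : {m : Fin N // m ≠ n}, S m.val, ∑ sn : S n,
    μ so * τn sn * G n (combine n sn so)

/-- Lexicographic comparison of the first k+1 entries (indices 0,…,k) of two sequences. -/
def lexGe (k : ℕ) (a b : ℕ → ℝ) : Prop :=
  (∀ i ≤ k, a i = b i) ∨ ∃ i ≤ k, (∀ j < i, a j = b j) ∧ b i < a i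

/-- τn is a best reply of order k against the LPS profile ϱ. -/
noncomputable def lpsBestReply {S : Fin N → Type} [∀ n, Fintype (S n)] [∀ n, DecidableEq (S n)]
    (G : Fin N → (∀ m, S m) → ℝ) {K : ℕ} (ϱ : ∀ n, Fin (K+1) → S n → ℝ)
    (n : Fin N) (τn : S n → ℝ) (k : ℕ) : Prop :=
  ∀ sn : S n,
    lexGe k (fun i => beliefPayoff G n τn (belief ϱ n i))
            (fun i => beliefPayoff G n (pureStrat sn) (belief ϱ n i))

/-- A polynomial strategy profile. -/
abbrev PolyProfile (S : Fin N → Type) := ∀ n, S n → Polynomial ℝ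

/-- f > 0 for a univariate real polynomial: the trailing (lowest-order) coefficient is positive. -/
def polyPos (f : Polynomial ℝ) : Prop := 0 < f.trailingCoeff

/-- f ≥ 0 : f is identically zero or its trailing coefficient is positive. -/
def polyNonneg (f : Polynomial ℝ) : Prop := f = 0 ∨ 0 < f.trailingCoeff

/-- The order o(η) of a polynomial strategy profile (∞ if some coordinate is zero). -/
noncomputable def polyOrder {S : Fin N → Type} [∀ n, Fintype (S n)]
    (η : PolyProfile S) : ℕ∞ :=
  Finset.univ.sup fun p : Σ n, S n => (η p.1 p.2).trailingDegree

/-- The polynomial t ↦ G_n(τn, η_{-n}(t)). -/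
noncomputable def payoffPoly {S : Fin N → Type} [∀ n, Fintype (S n)]
    (G : Fin N → (∀ m, S m) → ℝ) (η : PolyProfile S) (n : Fin N) (τn : S n → ℝ) :
    Polynomial ℝ :=
  ∑ s : ∀ m, S m,
    (Polynomial.C (τn (s n)) * ∏ m ∈ Finset.univ.erase n, η m (s m)) * Polynomial.C (G n s)

/-- τn is a best reply of order r against the polynomial strategy profile η. -/
noncomputable def polyBestReply {S : Fin N → Type} [∀ n, Fintype (S n)] [∀ n, DecidableEq (S n)]
    (G : Fin N → (∀ m, S m) → ℝ) (η : PolyProfile S) (n : Fin N) (τn : S n → ℝ) (r : ℕ) : Prop :=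
  ∀ sn : S n,
    polyNonneg (payoffPoly G η n τn - payoffPoly G η n (pureStrat sn)) ∨
    ((r + 1 : ℕ) : ℕ∞) ≤ (payoffPoly G η n τn - payoffPoly G η n (pureStrat sn)).trailingDegree

section OrderedField

open ArchimedeanClass

variable {K : Type*} [Field K] [LinearOrder K] [IsStrictOrderedRing K]

theorem mk_add_ge {x y : K} {c : ArchimedeanClass K} (hx : c ≤ mk x) (hy : c ≤ mk y) :
    c ≤ mk (x + y) :=
  (le_min hx hy).trans (min_le_mk_add x y)

theorem mk_sub_ge {x y : K} {c : ArchimedeanClass K} (hx : c ≤ mk x) (hy : c ≤ mk y) :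
    c ≤ mk (x - y) :=
  (le_min hx hy).trans (min_le_mk_sub x y)

theorem mk_sum_ge {ι : Type*} (s : Finset ι) {f : ι → K} {c : ArchimedeanClass K}
    (h : ∀ i ∈ s, c ≤ mk (f i)) : c ≤ mk (∑ i ∈ s, f i) := by
  classical
  induction s using Finset.induction_on with
  | empty => simp
  | insert a s ha ih =>
    rw [Finset.sum_insert ha]
    exact mk_add_ge (h a (by simp)) (ih fun i hi => h i (by simp [hi]))

theorem mk_mul_ge_left {x y : K} {c : ArchimedeanClass K} (hx : 0 ≤ mk x) (hy : c ≤ mk y) :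
    c ≤ mk (x * y) := by
  rw [mk_mul]
  calc c = 0 + c := (zero_add c).symm
    _ ≤ mk x + mk y := add_le_add hx hy

theorem mk_mul_ge_right {x y : K} {c : ArchimedeanClass K} (hx : c ≤ mk x) (hy : 0 ≤ mk y) :
    c ≤ mk (x * y) := by
  rw [mul_comm]
  exact mk_mul_ge_left hy hx

theorem pow_nsmul_le {t : K} (ht : 0 < mk t) {m n : ℕ} (h : m ≤ n) :
    m • mk t ≤ n • mk t := nsmul_le_nsmul_left ht.le h

/-- `c • mk x` for `x ≠ 0` behaves as in a linearly ordered group. -/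
theorem zsmul_mk_lt {t : K} (ht0 : t ≠ 0) (ht : 0 < mk t) {m n : ℤ} (h : m < n) :
    m • mk t < n • mk t := by
  have h1 : n • mk t = m • mk t + (n - m).toNat • mk t := by
    rw [← mk_zpow, ← mk_zpow, ← mk_pow, ← mk_mul]
    congr 1
    rw [← zpow_natCast, ← zpow_add₀ ht0]
    congr 1
    omega
  have h2 : 0 < (n - m).toNat • mk t := by
    have : mk t ≤ (n - m).toNat • mk t := by
      simpa using pow_nsmul_le ht (show 1 ≤ (n - m).toNat by omega)
    exact lt_of_lt_of_le ht this
  rw [h1]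
  have h3 : m • mk t ≠ ⊤ := by
    rw [← mk_zpow, Ne, mk_eq_top_iff]
    exact zpow_ne_zero _ ht0
  refine lt_of_le_of_ne (le_add_of_nonneg_right h2.le) ?_
  intro h4
  have h5 := add_left_cancel_of_ne_top (x := m • mk t) (y := 0) (z := (n - m).toNat • mk t)
    h3 (by rw [add_zero]; exact h4)
  exact h2.ne h5

theorem zsmul_mk_le_iff {t : K} (ht0 : t ≠ 0) (ht : 0 < mk t) {m n : ℤ} :
    m • mk t ≤ n • mk t ↔ m ≤ n := by
  constructor
  · intro h
    by_contra h'
    exact absurd h (not_le.mpr (zsmul_mk_lt ht0 ht (not_le.mp h')))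
  · intro h
    rcases h.eq_or_lt with rfl | h
    · exact le_rfl
    · exact (zsmul_mk_lt ht0 ht h).le

theorem zsmul_mk_inj {t : K} (ht0 : t ≠ 0) (ht : 0 < mk t) {m n : ℤ}
    (h : m • mk t = n • mk t) : m = n :=
  le_antisymm ((zsmul_mk_le_iff ht0 ht).mp h.le) ((zsmul_mk_le_iff ht0 ht).mp h.ge)

theorem nsmul_mk_le_iff {t : K} (ht0 : t ≠ 0) (ht : 0 < mk t) {m n : ℕ} :
    m • mk t ≤ n • mk t ↔ m ≤ n := by
  have := zsmul_mk_le_iff ht0 ht (m := m) (n := n)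
  rw [natCast_zsmul, natCast_zsmul] at this
  rw [this]
  exact Int.ofNat_le

theorem eq_of_nsmul_mk_eq {x y : K} {n : ℕ} (hn : n ≠ 0) (h : n • mk x = n • mk y) :
    mk x = mk y := by
  by_cases hx : x = 0
  · subst hx
    have h1 : mk (y ^ n) = ⊤ := by
      rw [mk_pow, ← h, ← mk_pow, zero_pow hn, mk_zero]
    rw [mk_eq_top_iff] at h1
    rw [pow_eq_zero_iff hn] at h1
    rw [h1]
  by_cases hy : y = 0
  · subst hy
    have h1 : mk (x ^ n) = ⊤ := by
      rw [mk_pow, h, ← mk_pow, zero_pow hn, mk_zero]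
    rw [mk_eq_top_iff] at h1
    rw [pow_eq_zero_iff hn] at h1
    exact absurd h1 hx
  have key : ∀ {x y : K}, x ≠ 0 → y ≠ 0 → n • mk x = n • mk y → mk x ≤ mk y := by
    intro x y hx hy h
    by_contra hlt
    rw [not_le] at hlt
    have hz0 : x / y ≠ 0 := div_ne_zero hx hy
    have hz : 0 < mk (x / y) := by
      by_contra hle
      rw [not_lt] at hle
      have : mk x ≤ mk y := by
        calc mk x = mk (x / y * y) := by rw [div_mul_cancel₀ _ hy]
          _ = mk (x / y) + mk y := mk_mul _ _
          _ ≤ 0 + mk y := add_le_add hle le_rfl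
          _ = mk y := zero_add _
      exact absurd this (not_le.mpr hlt)
    have h0 : n • mk (x / y) = 0 := by
      have h1 : mk ((x / y) ^ n) = 0 := by
        have h2 : mk (y ^ n) ≠ ⊤ := by
          rw [Ne, mk_eq_top_iff]; exact pow_ne_zero _ hy
        apply add_left_cancel_of_ne_top h2
        rw [← mk_mul, add_zero, ← mul_pow, mul_div_cancel₀ _ hy, mk_pow, mk_pow, h]
      rwa [mk_pow] at h1
    have h3 : n • mk (x / y) = 0 • mk (x / y) := by rw [h0, zero_nsmul]
    have := (nsmul_mk_le_iff hz0 hz).mp h3.le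
    omega
  exact le_antisymm (key hx hy h) (key hy hx h.symm)

/-- In a vanishing sum, two nonzero terms have the same class. -/
theorem exists_mk_eq_of_sum_eq_zero {n : ℕ} {a : Fin n → K} (h : ∑ i, a i = 0)
    (hne : ∃ i, a i ≠ 0) : ∃ i j, i < j ∧ a i ≠ 0 ∧ mk (a i) = mk (a j) := by
  classical
  obtain ⟨i0, hi0⟩ := hne
  obtain ⟨i, -, himin⟩ := Finset.exists_min_image Finset.univ (fun i => mk (a i)) ⟨i0, by simp⟩
  have hai : a i ≠ 0 := by
    intro h0
    have := himin i0 (by simp)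
    simp [h0] at this
    exact hi0 this
  by_cases hj : ∃ j, j ≠ i ∧ mk (a i) = mk (a j)
  · obtain ⟨j, hji, hj⟩ := hj
    have haj : a j ≠ 0 := by
      rw [Ne, ← mk_eq_top_iff, ← hj, mk_eq_top_iff]; exact hai
    rcases lt_or_gt_of_ne hji with h1 | h1
    · exact ⟨j, i, h1, haj, hj.symm⟩
    · exact ⟨i, j, h1, hai, hj⟩
  · push Not at hj
    exfalso
    have h2 : a i = -∑ j ∈ Finset.univ.erase i, a j := by
      rw [← Finset.add_sum_erase _ _ (Finset.mem_univ i)] at h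
      linear_combination h
    have h3 : ∀ s : Finset (Fin n), i ∉ s → mk (a i) < mk (∑ j ∈ s, a j) := by
      intro s
      induction s using Finset.induction_on with
      | empty =>
        intro _
        simpa [lt_top_iff_ne_top] using hai
      | insert b s hb ih =>
        intro hi
        rw [Finset.mem_insert, not_or] at hi
        rw [Finset.sum_insert hb]
        refine lt_of_lt_of_le (lt_min ?_ (ih hi.2)) (min_le_mk_add _ _)
        exact lt_of_le_of_ne (himin b (by simp)) (hj b (Ne.symm hi.1))
    have h4 := h3 (Finset.univ.erase i) (by simp)
    rw [h2, mk_neg] at h4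
    exact absurd h4 (lt_irrefl _)

/-- `z` has ramification at most `Δ` over the powers of `τ`. -/
def RamifiedLE (τ : K) (Δ : ℕ) (z : K) : Prop :=
  z ≠ 0 → ∃ b : ℕ, 1 ≤ b ∧ b ≤ Δ ∧ ∃ a : ℤ, b • mk z = a • mk τ

variable [Algebra ℝ K]

/-- The structure map of an ordered real algebra, as an ordered ring homomorphism. -/
noncomputable def realHom (K : Type*) [Field K] [LinearOrder K] [IsStrictOrderedRing K]
    [Algebra ℝ K] : ℝ →+*o K where
  toRingHom := algebraMap ℝ K
  monotone' := by
    intro a b hab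
    have h : algebraMap ℝ K b = algebraMap ℝ K a + algebraMap ℝ K (√(b - a)) ^ 2 := by
      rw [← map_pow, ← map_add, Real.sq_sqrt (by linarith)]
      congr 1
      ring
    change algebraMap ℝ K a ≤ algebraMap ℝ K b
    rw [h]
    linarith [sq_nonneg (algebraMap ℝ K (√(b - a)))]

theorem realHom_apply (r : ℝ) : realHom K r = algebraMap ℝ K r := rfl

theorem algebraMap_le_algebraMap_real {a b : ℝ} (h : a ≤ b) :
    algebraMap ℝ K a ≤ algebraMap ℝ K b :=
  (realHom K).monotone' h

theorem algebraMap_pos_real {a : ℝ} (h : 0 < a) : 0 < algebraMap ℝ K a := by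
  have := algebraMap_le_algebraMap_real (K := K) h.le
  rw [map_zero] at this
  exact lt_of_le_of_ne this (Ne.symm (by simpa using h.ne'))

theorem mk_algebraMap_real {r : ℝ} (hr : r ≠ 0) : mk (algebraMap ℝ K r) = 0 :=
  mk_map_of_archimedean' (realHom K) hr

theorem mk_algebraMap_real_nonneg (r : ℝ) : 0 ≤ mk (algebraMap ℝ K r) :=
  mk_map_nonneg_of_archimedean (realHom K) r

theorem mk_add_eq_zero {r : ℝ} (hr : r ≠ 0) {x : K} (hx : 0 < mk x) :
    mk (algebraMap ℝ K r + x) = 0 := by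
  rw [mk_add_eq_mk_left, mk_algebraMap_real hr]
  rwa [mk_algebraMap_real hr]

theorem exists_mk_aeval_eq {τ : K} (hτ : 0 < mk τ) (p : Polynomial ℝ)
    (hp : p ≠ 0) : ∃ k : ℕ, mk (Polynomial.aeval τ p) = k • mk τ := by
  have hfin : ∀ p : Polynomial ℝ, 0 ≤ mk (Polynomial.aeval τ p) := by
    intro p
    rw [Polynomial.aeval_eq_sum_range]
    refine mk_sum_ge _ fun i _ => ?_
    rw [Algebra.smul_def]
    refine mk_mul_ge_left (mk_algebraMap_real_nonneg _) ?_
    rw [mk_pow]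
    exact nsmul_nonneg hτ.le _
  obtain ⟨q, hq, hndvd⟩ := Polynomial.exists_eq_pow_rootMultiplicity_mul_and_not_dvd p hp 0
  rw [Polynomial.C_0, sub_zero] at hq hndvd
  refine ⟨p.rootMultiplicity 0, ?_⟩
  have hq0 : q.coeff 0 ≠ 0 := by rwa [Polynomial.X_dvd_iff] at hndvd
  have hq1 : mk (Polynomial.aeval τ q) = 0 := by
    have h1 : Polynomial.aeval τ q = algebraMap ℝ K (q.coeff 0) + Polynomial.aeval τ q.divX * τ := by
      conv_lhs => rw [← Polynomial.divX_mul_X_add q]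
      simp [add_comm]
    rw [h1]
    apply mk_add_eq_zero hq0
    rw [mk_mul]
    exact lt_of_lt_of_le hτ (le_add_of_nonneg_left (hfin _))
  conv_lhs => rw [hq]
  rw [map_mul, map_pow, Polynomial.aeval_X, mk_mul, hq1, add_zero, mk_pow]

theorem exists_mk_eq_of_mem_adjoin {τ : K} (hτ0 : τ ≠ 0) (hτ : 0 < mk τ) {c : K}
    (hc : c ∈ IntermediateField.adjoin ℝ {τ}) (hc0 : c ≠ 0) : ∃ a : ℤ, mk c = a • mk τ := by
  obtain ⟨r, s, rfl⟩ := (IntermediateField.mem_adjoin_simple_iff ℝ c).mp hc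
  have hr : r ≠ 0 := by rintro rfl; simp at hc0
  have hs : s ≠ 0 := by rintro rfl; simp at hc0
  obtain ⟨m, hm⟩ := exists_mk_aeval_eq hτ r hr
  obtain ⟨n, hn⟩ := exists_mk_aeval_eq hτ s hs
  refine ⟨(m : ℤ) - n, ?_⟩
  rw [div_eq_mul_inv, mk_mul, mk_inv, hm, hn, ← mk_pow, ← mk_pow, ← mk_inv, ← mk_mul, ← mk_zpow]
  congr 1
  rw [zpow_sub₀ hτ0, zpow_natCast, zpow_natCast, div_eq_mul_inv]

theorem ramifiedLE_of_finrank_le {τ : K} (hτ0 : τ ≠ 0) (hτ : 0 < mk τ)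
    (B : Subalgebra (IntermediateField.adjoin ℝ {τ}) K)
    [FiniteDimensional (IntermediateField.adjoin ℝ {τ}) B] {Δ : ℕ}
    (hΔ : Module.finrank (IntermediateField.adjoin ℝ {τ}) B ≤ Δ) {z : K} (hz : z ∈ B) :
    RamifiedLE τ Δ z := by
  intro hz0
  have hdep : ¬ LinearIndependent (IntermediateField.adjoin ℝ {τ})
      (fun i : Fin (Δ + 1) => (⟨z, hz⟩ : B) ^ (i : ℕ)) := by
    intro hli
    have := hli.fintype_card_le_finrank
    simp at this
    omega
  rw [Fintype.not_linearIndependent_iff] at hdep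
  obtain ⟨g, hg, i0, hi0⟩ := hdep
  have hg' : ∑ i, (g i : K) * z ^ (i : ℕ) = 0 := by
    have := congrArg (B.val) hg
    simpa [Algebra.smul_def] using this
  obtain ⟨i, j, hij, hi, heq⟩ := exists_mk_eq_of_sum_eq_zero hg'
    ⟨i0, mul_ne_zero (by simpa using hi0) (pow_ne_zero _ hz0)⟩
  have hgi : (g i : K) ≠ 0 := left_ne_zero_of_mul hi
  have hj : (g j : K) * z ^ (j : ℕ) ≠ 0 := by
    rw [Ne, ← mk_eq_top_iff, ← heq, mk_eq_top_iff]; exact hi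
  have hgj : (g j : K) ≠ 0 := left_ne_zero_of_mul hj
  obtain ⟨a, ha⟩ := exists_mk_eq_of_mem_adjoin hτ0 hτ
    (div_mem (g i).2 (g j).2) (div_ne_zero hgi hgj)
  have hij' : (i : ℕ) < j := hij
  refine ⟨j - i, by omega, by omega, a, ?_⟩
  rw [← ha, ← mk_pow]
  have hne : mk ((g j : K) * z ^ (i : ℕ)) ≠ ⊤ := by
    rw [Ne, mk_eq_top_iff]; exact mul_ne_zero hgj (pow_ne_zero _ hz0)
  apply add_left_cancel_of_ne_top hne
  rw [← mk_mul, ← mk_mul]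
  have e1 : (g j : K) * z ^ (i : ℕ) * z ^ ((j : ℕ) - i) = (g j : K) * z ^ (j : ℕ) := by
    rw [mul_assoc, ← pow_add]; congr 2; omega
  have e2 : (g j : K) * z ^ (i : ℕ) * ((g i : K) / (g j : K)) = (g i : K) * z ^ (i : ℕ) := by
    field_simp
  rw [e1, e2, heq]

end OrderedField

section Expansion

open ArchimedeanClass

variable {K : Type*} [Field K] [LinearOrder K] [IsStrictOrderedRing K]

theorem pos_mk_of_mk_eq_nsmul {τ t : K} {e : ℕ} (hτ : 0 < mk τ) (h : mk τ = e • mk t) :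
    0 < mk t := by
  by_contra hle
  rw [not_lt] at hle
  rw [h] at hτ
  exact absurd hτ (not_lt.mpr (nsmul_nonpos hle e))

variable [Algebra ℝ K]

/-- A field of bounded ramification over the powers of `τ` has a uniformizer. -/
theorem exists_uniformizer (L : IntermediateField ℝ K) {τ : K} (hτL : τ ∈ L) (hτ0 : 0 < τ)
    (hτ : 0 < mk τ) {Δ : ℕ} (hL : ∀ z ∈ L, RamifiedLE τ Δ z) :
    ∃ t ∈ L, 0 < t ∧ 0 < mk t ∧ (∃ e : ℕ, e ≤ Δ ∧ mk τ = e • mk t) ∧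
      ∀ z ∈ L, z ≠ 0 → ∃ k : ℤ, mk z = k • mk t := by
  classical
  have hfac : ∀ z ∈ L, z ≠ 0 → ∃ w : ℤ, mk (z ^ Δ.factorial) = mk (τ ^ w) := by
    intro z hz hz0
    obtain ⟨b, hb1, hbΔ, a, hab⟩ := hL z hz hz0
    obtain ⟨c, hc⟩ := Nat.dvd_factorial hb1 hbΔ
    refine ⟨a * c, ?_⟩
    rw [hc, pow_mul, mk_pow, mk_pow, hab, zpow_mul, zpow_natCast, mk_pow, mk_zpow]
  have hex : ∃ n : ℕ, 1 ≤ n ∧ ∃ z ∈ L, z ≠ 0 ∧ mk (z ^ Δ.factorial) = mk (τ ^ n) :=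
    ⟨Δ.factorial, Nat.factorial_pos Δ, τ, hτL, hτ0.ne', rfl⟩
  obtain ⟨hn1, t, htL, ht0, htn⟩ := Nat.find_spec hex
  have hmin := fun m => Nat.find_min (m := m) hex
  generalize Nat.find hex = n at hn1 htn hmin
  have hunif : ∀ z ∈ L, z ≠ 0 → ∃ k : ℤ, mk z = k • mk t := by
    intro z hz hz0
    obtain ⟨w, hw⟩ := hfac z hz hz0
    set q := w / n with hq
    set r := (w % n).toNat with hr
    have hn0 : (n : ℤ) ≠ 0 := by omega
    have hrn : (r : ℤ) = w % n := Int.toNat_of_nonneg (Int.emod_nonneg _ hn0)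
    have hrlt : r < n := by
      have := Int.emod_lt_of_pos w (show (0 : ℤ) < n by omega)
      omega
    have hwqr : w = n * q + r := by
      rw [hrn, hq]
      have := Int.emod_add_mul_ediv w n
      linarith
    have hclass : mk ((z * t ^ (-q)) ^ Δ.factorial) = mk (τ ^ r) := by
      have : (z * t ^ (-q)) ^ Δ.factorial = z ^ Δ.factorial * (t ^ Δ.factorial) ^ (-q) := by
        rw [mul_pow, ← zpow_natCast (t ^ (-q)), ← zpow_mul, mul_comm (-q), zpow_mul, zpow_natCast]
      rw [this, mk_mul, hw, mk_zpow _ (t ^ _), htn, ← mk_zpow, ← mk_mul, hwqr, zpow_add₀ hτ0.ne', zpow_mul,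
        zpow_natCast, zpow_natCast, zpow_neg]
      congr 1
      have : (τ ^ n) ^ q ≠ 0 := zpow_ne_zero _ (pow_ne_zero _ hτ0.ne')
      field_simp
    have hr0 : r = 0 := by
      by_contra hr0
      exact hmin r hrlt ⟨by omega, z * t ^ (-q), mul_mem hz (zpow_mem htL _),
        mul_ne_zero hz0 (zpow_ne_zero _ ht0), hclass⟩
    refine ⟨q, ?_⟩
    rw [hr0, pow_zero, mk_pow] at hclass
    have h1 : mk (z * t ^ (-q)) = mk 1 := by
      refine eq_of_nsmul_mk_eq (Nat.factorial_ne_zero Δ) ?_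
      rw [hclass, ← mk_pow, one_pow]
    calc mk z = mk (z * t ^ (-q) * t ^ q) := by
          rw [mul_assoc, ← zpow_add₀ ht0, neg_add_cancel, zpow_zero, mul_one]
      _ = q • mk t := by rw [mk_mul, h1, ← mk_mul, one_mul, mk_zpow]
  have htpos : 0 < mk t := by
    refine pos_mk_of_mk_eq_nsmul (τ := τ ^ n) (e := Δ.factorial) ?_ ?_
    · rw [mk_pow]
      exact lt_of_lt_of_le hτ (by simpa using pow_nsmul_le hτ hn1)
    · rw [← htn, mk_pow]
  obtain ⟨k, hk⟩ := hunif τ hτL hτ0.ne'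
  have hkpos : 0 < k := by
    by_contra hk0
    rw [not_lt] at hk0
    have := (zsmul_mk_le_iff ht0 htpos).mpr hk0
    rw [← hk, zero_zsmul] at this
    exact absurd hτ (not_lt.mpr this)
  refine ⟨|t|, by rcases abs_choice t with h | h <;> rw [h] <;> simp [htL], abs_pos.mpr ht0,
    by rwa [mk_abs], ⟨k.toNat, ?_, ?_⟩, fun z hz hz0 => by rw [mk_abs]; exact hunif z hz hz0⟩
  · obtain ⟨b, hb1, hbΔ, a, hab⟩ := hL t htL ht0
    have hb : (b : ℤ) = k * a := by
      refine zsmul_mk_inj ht0 htpos ?_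
      rw [natCast_zsmul, hab, ← mk_zpow, ← mk_zpow, zpow_mul, mk_zpow, hk, ← mk_zpow, ← mk_zpow]
    have := Int.le_of_dvd (by omega) (Dvd.intro _ hb.symm)
    omega
  · rw [mk_abs, hk]
    conv_lhs => rw [← Int.toNat_of_nonneg hkpos.le]
    rw [natCast_zsmul]

/-- Finite elements of a field with uniformizer `t` have power series expansions in `t`. -/
theorem exists_expansion (L : IntermediateField ℝ K) {t : K} (htL : t ∈ L) (ht0 : 0 < t)
    (ht : 0 < mk t) (hL : ∀ z ∈ L, z ≠ 0 → ∃ k : ℤ, mk z = k • mk t) (n : ℕ) :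
    ∀ z ∈ L, 0 ≤ mk z → ∃ p : ℕ → ℝ,
      n • mk t ≤ mk (z - ∑ k ∈ Finset.range n, algebraMap ℝ K (p k) * t ^ k) := by
  induction n with
  | zero =>
    intro z _ hz
    exact ⟨0, by simpa using hz⟩
  | succ n ih =>
    intro z hzL hz
    set w := z - algebraMap ℝ K (stdPart z) with hw
    have hwL : w ∈ L := sub_mem hzL (L.algebraMap_mem _)
    have hwpos : 0 < mk w := by
      rw [hw, ← realHom_apply]
      exact mk_sub_stdPart_pos (realHom K) hz
    have hdiv : 0 ≤ mk (w / t) := by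
      by_cases hw0 : w = 0
      · simp [hw0]
      obtain ⟨k, hk⟩ := hL w hwL hw0
      have hk1 : 1 ≤ k := by
        by_contra hk1
        have := (zsmul_mk_le_iff ht0.ne' ht).mpr (show k ≤ 0 by omega)
        rw [← hk, zero_zsmul] at this
        exact absurd hwpos (not_lt.mpr this)
      have : mk (w / t) = (k - 1) • mk t := by
        rw [div_eq_mul_inv, mk_mul, hk, ← mk_zpow, ← mk_mul, ← mk_zpow, zpow_sub_one₀ ht0.ne']
      rw [this]
      have := (zsmul_mk_le_iff ht0.ne' ht).mpr (show 0 ≤ k - 1 by omega)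
      rwa [zero_zsmul] at this
    obtain ⟨p, hp⟩ := ih (w / t) (div_mem hwL htL) hdiv
    refine ⟨fun k => Nat.casesOn k (stdPart z) p, ?_⟩
    have : z - ∑ k ∈ Finset.range (n + 1),
        algebraMap ℝ K (Nat.casesOn k (stdPart z) p : ℝ) * t ^ k =
        (w / t - ∑ k ∈ Finset.range n, algebraMap ℝ K (p k) * t ^ k) * t := by
      rw [Finset.sum_range_succ', sub_mul, div_mul_cancel₀ _ ht0.ne', Finset.sum_mul, hw]
      simp only [pow_zero, mul_one, pow_succ, mul_assoc]
      exact sub_add_eq_sub_sub_swap _ _ _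
    rw [this, mk_mul, succ_nsmul]
    exact add_le_add hp le_rfl

theorem sum_pow_eq_leading {t : K} (ht : 0 < mk t) (c : ℕ → ℝ) {n p : ℕ} (hp : p < n)
    (hc : ∀ j < p, c j = 0) : ∃ δ : K, 0 < mk δ ∧
      ∑ k ∈ Finset.range n, algebraMap ℝ K (c k) * t ^ k =
        t ^ p * (algebraMap ℝ K (c p) + δ) := by
  obtain ⟨m, rfl⟩ : ∃ m, n = p + (m + 1) := ⟨n - p - 1, by omega⟩
  refine ⟨∑ k ∈ Finset.range m, algebraMap ℝ K (c (p + (k + 1))) * t ^ (k + 1), ?_, ?_⟩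
  · refine lt_of_lt_of_le ht (mk_sum_ge _ fun i _ => ?_)
    refine mk_mul_ge_left (mk_algebraMap_real_nonneg _) ?_
    rw [mk_pow]
    simpa using pow_nsmul_le ht (show 1 ≤ i + 1 by omega)
  · rw [Finset.sum_range_add, Finset.sum_eq_zero, zero_add, Finset.sum_range_succ']
    · rw [mul_add, Finset.mul_sum, add_comm]
      congr 1
      · simp [mul_comm]
      · refine Finset.sum_congr rfl fun k _ => ?_
        rw [pow_add]
        ring
    · intro k hk
      rw [hc k (Finset.mem_range.mp hk), map_zero, zero_mul]

theorem mk_sum_pow {t : K} (ht : 0 < mk t) (c : ℕ → ℝ) {n p : ℕ} (hp : p < n)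
    (hc : ∀ j < p, c j = 0) (hcp : c p ≠ 0) :
    mk (∑ k ∈ Finset.range n, algebraMap ℝ K (c k) * t ^ k) = p • mk t := by
  obtain ⟨δ, hδ, h⟩ := sum_pow_eq_leading ht c hp hc
  rw [h, mk_mul, mk_add_eq_zero hcp hδ, add_zero, mk_pow]

theorem add_pos_of_infinitesimal {r : ℝ} (hr : 0 < r) {δ : K} (hδ : 0 < mk δ) :
    0 < algebraMap ℝ K r + δ := by
  have h : mk (algebraMap ℝ K r) < mk δ := by rwa [mk_algebraMap_real hr.ne']
  have := mk_lt_mk.mp h 1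
  rw [one_nsmul, abs_of_pos (algebraMap_pos_real (K := K) hr)] at this
  linarith [neg_abs_le δ]

theorem sum_pow_pos {t : K} (ht0 : 0 < t) (ht : 0 < mk t) (c : ℕ → ℝ) {n p : ℕ} (hp : p < n)
    (hc : ∀ j < p, c j = 0) (hcp : 0 < c p) :
    0 < ∑ k ∈ Finset.range n, algebraMap ℝ K (c k) * t ^ k := by
  obtain ⟨δ, hδ, h⟩ := sum_pow_eq_leading ht c hp hc
  rw [h]
  exact mul_pos (pow_pos ht0 _) (add_pos_of_infinitesimal hcp hδ)

theorem forall_eq_zero_or_exists_first {c : ℕ → ℝ} (n : ℕ) :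
    (∀ k < n, c k = 0) ∨ ∃ p < n, (∀ j < p, c j = 0) ∧ c p ≠ 0 := by
  classical
  by_cases h : ∃ p, p < n ∧ c p ≠ 0
  · right
    refine ⟨Nat.find h, (Nat.find_spec h).1, fun j hj => ?_, (Nat.find_spec h).2⟩
    by_contra hne
    exact Nat.find_min h hj ⟨hj.trans (Nat.find_spec h).1, hne⟩
  · left
    push Not at h
    exact h

theorem coeff_eq_zero_of_mk_ge {t : K} (ht0 : t ≠ 0) (ht : 0 < mk t) {c : ℕ → ℝ} {n : ℕ}
    (h : n • mk t ≤ mk (∑ k ∈ Finset.range n, algebraMap ℝ K (c k) * t ^ k)) :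
    ∀ k < n, c k = 0 := by
  rcases forall_eq_zero_or_exists_first (c := c) n with h0 | ⟨p, hp, hc, hcp⟩
  · exact h0
  · rw [mk_sum_pow ht c hp hc hcp, nsmul_mk_le_iff ht0 ht] at h
    omega

theorem lex_of_infinitesimal_le {t : K} (ht0 : 0 < t) (ht : 0 < mk t) {c : ℕ → ℝ} {n : ℕ} {v : K}
    (hv : n • mk t ≤ mk v) (h : v ≤ ∑ k ∈ Finset.range n, algebraMap ℝ K (c k) * t ^ k) :
    (∀ k < n, c k = 0) ∨ ∃ p < n, (∀ j < p, c j = 0) ∧ 0 < c p := by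
  rcases forall_eq_zero_or_exists_first (c := c) n with h0 | ⟨p, hp, hc, hcp⟩
  · exact Or.inl h0
  · refine Or.inr ⟨p, hp, hc, ?_⟩
    by_contra hneg
    have hneg : c p < 0 := lt_of_le_of_ne (not_lt.mp hneg) hcp
    have hmk := mk_sum_pow (K := K) ht c hp hc hcp
    have hs : 0 < ∑ k ∈ Finset.range n, algebraMap ℝ K (-c k) * t ^ k :=
      sum_pow_pos ht0 ht (fun k => -c k) hp (fun j hj => by simp [hc j hj]) (by simpa using hneg)
    simp only [map_neg, neg_mul, Finset.sum_neg_distrib] at hs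
    have h1 : mk v ≤ p • mk t := by
      rw [← hmk]
      exact mk_monotoneOn (h.trans (by linarith)) (Set.mem_Iic.mpr (by linarith)) h
    have := (nsmul_mk_le_iff ht0.ne' ht).mp (hv.trans h1)
    omega

theorem sum_pow_nonneg_of_lex {t : K} (ht0 : 0 < t) (ht : 0 < mk t) {c : ℕ → ℝ} {n : ℕ}
    (h : (∀ k < n, c k = 0) ∨ ∃ p < n, (∀ j < p, c j = 0) ∧ 0 < c p) :
    0 ≤ ∑ k ∈ Finset.range n, algebraMap ℝ K (c k) * t ^ k := by
  rcases h with h | ⟨p, hp, hc, hcp⟩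
  · rw [Finset.sum_eq_zero]
    intro k hk
    rw [h k (Finset.mem_range.mp hk), map_zero, zero_mul]
  · exact (sum_pow_pos ht0 ht c hp hc hcp).le

theorem mk_aeval_nonneg {ι : Type*} (p : MvPolynomial ι ℝ) {x : ι → K} (hx : ∀ i, 0 ≤ mk (x i)) :
    0 ≤ mk (MvPolynomial.aeval x p) := by
  induction p using MvPolynomial.induction_on with
  | C a => simpa using mk_algebraMap_real_nonneg a
  | add p q hp hq => rw [map_add]; exact mk_add_ge hp hq
  | mul_X p i hp =>
    rw [map_mul, MvPolynomial.aeval_X]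
    exact mk_mul_ge_left hp (hx i)

theorem mk_aeval_sub_ge {ι : Type*} (p : MvPolynomial ι ℝ) {x y : ι → K} {c : ArchimedeanClass K}
    (hx : ∀ i, 0 ≤ mk (x i)) (hy : ∀ i, 0 ≤ mk (y i)) (h : ∀ i, c ≤ mk (x i - y i)) :
    c ≤ mk (MvPolynomial.aeval x p - MvPolynomial.aeval y p) := by
  induction p using MvPolynomial.induction_on with
  | C a => simp
  | add p q hp hq =>
    rw [map_add, map_add, add_sub_add_comm]
    exact mk_add_ge hp hq
  | mul_X p i hp =>
    have : MvPolynomial.aeval x (p * MvPolynomial.X i) -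
        MvPolynomial.aeval y (p * MvPolynomial.X i) =
        (MvPolynomial.aeval x p - MvPolynomial.aeval y p) * x i +
        MvPolynomial.aeval y p * (x i - y i) := by
      simp only [map_mul, MvPolynomial.aeval_X]
      ring
    rw [this]
    exact mk_add_ge (mk_mul_ge_right hp (hx i)) (mk_mul_ge_left (mk_aeval_nonneg p hy) (h i))

end Expansion

section FiniteDimensional

open MvPolynomial in
/-- If every `x i ^ D` is a polynomial of degree `< D` in `x`, then the monomials with exponents
`< D` span the algebra generated by `x`. -/
theorem aeval_mem_span_of_pow_eq {F K ι : Type*} [Fintype ι] [Field F] [Field K] [Algebra F K]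
    {x : ι → K} {D : ℕ} {q : ι → MvPolynomial ι F} (hq : ∀ i, (q i).totalDegree < D)
    (hx : ∀ i, x i ^ D = aeval x (q i)) (n : ℕ) :
    ∀ p : MvPolynomial ι F, p.totalDegree ≤ n →
      aeval x p ∈ Submodule.span F (Set.range fun e : ι → Fin D => ∏ i, x i ^ (e i : ℕ)) := by
  classical
  induction n using Nat.strong_induction_on with
  | _ n ih =>
    intro p hp
    rw [p.as_sum, map_sum]
    refine Submodule.sum_mem _ fun m hm => ?_
    have hmn : m.degree ≤ n := by
      rw [Finsupp.degree_eq_sum]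
      have := (le_totalDegree hm).trans hp
      rwa [Finsupp.sum_fintype _ _ (fun _ => rfl)] at this
    rw [← mul_one (coeff m p), ← smul_eq_mul, ← smul_monomial, map_smul]
    refine Submodule.smul_mem _ _ ?_
    by_cases hsmall : ∀ i, m i < D
    · refine Submodule.subset_span ⟨fun i => ⟨m i, hsmall i⟩, ?_⟩
      rw [aeval_monomial, map_one, one_mul, Finsupp.prod_fintype _ _ (fun i => pow_zero _)]
    · push Not at hsmall
      obtain ⟨i, hi⟩ := hsmall
      have hm' : m = (m - Finsupp.single i D) + Finsupp.single i D := by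
        rw [tsub_add_cancel_of_le]
        simpa using hi
      have heq : aeval x (monomial m (1 : F)) =
          aeval x (monomial (m - Finsupp.single i D) (1 : F) * q i) := by
        conv_lhs => rw [hm', ← one_mul (1 : F), ← monomial_mul]
        rw [map_mul, map_mul, ← hx, aeval_monomial (d := Finsupp.single i D)]
        simp
      have hdeg : (m - Finsupp.single i D).degree + D = m.degree := by
        conv_rhs => rw [hm', map_add, Finsupp.degree_single]
      have hlt : (monomial (m - Finsupp.single i D) (1 : F) * q i).totalDegree < n := by
        refine lt_of_le_of_lt (totalDegree_mul _ _) ?_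
        rw [totalDegree_monomial _ one_ne_zero]
        have := hq i
        change (m - Finsupp.single i D).degree + _ < n
        omega
      rw [heq]
      exact ih _ hlt _ le_rfl

open ArchimedeanClass in
theorem exists_field_ramifiedLE {K ι : Type*} [Fintype ι] [Field K] [LinearOrder K]
    [IsStrictOrderedRing K] [Algebra ℝ K] {τ : K} (hτ0 : τ ≠ 0) (hτ : 0 < mk τ) {x : ι → K}
    {D : ℕ} {q : ι → MvPolynomial ι (IntermediateField.adjoin ℝ {τ})}
    (hq : ∀ i, (q i).totalDegree < D) (hx : ∀ i, x i ^ D = MvPolynomial.aeval x (q i)) :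
    ∃ L : IntermediateField ℝ K, τ ∈ L ∧ (∀ i, x i ∈ L) ∧
      ∀ z ∈ L, RamifiedLE τ (D ^ Fintype.card ι) z := by
  classical
  set F := IntermediateField.adjoin ℝ {τ}
  set V := Submodule.span F (Set.range fun e : ι → Fin D => ∏ i, x i ^ (e i : ℕ)) with hV
  set A : Subalgebra F K := (MvPolynomial.aeval (R := F) x).range
  have hAV : Subalgebra.toSubmodule A ≤ V := by
    rintro _ ⟨p, rfl⟩
    exact aeval_mem_span_of_pow_eq hq hx _ p le_rfl
  have : FiniteDimensional F V := FiniteDimensional.span_of_finite F (Set.finite_range _)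
  have : FiniteDimensional F (Subalgebra.toSubmodule A) := Submodule.finiteDimensional_of_le hAV
  have : FiniteDimensional F A := this
  have hfin : Module.finrank F A ≤ D ^ Fintype.card ι := by
    refine (Submodule.finrank_mono hAV).trans ((finrank_range_le_card _).trans ?_)
    simp
  have hinv : ∀ z ∈ A, z⁻¹ ∈ A := fun z hz =>
    A.inv_mem_of_algebraic (x := ⟨z, hz⟩) (Algebra.IsAlgebraic.isAlgebraic (⟨z, hz⟩ : A) |>.algebraMap)
  refine ⟨(A.toIntermediateField hinv).restrictScalars ℝ, ?_, ?_, ?_⟩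
  · exact A.algebraMap_mem (⟨τ, IntermediateField.mem_adjoin_simple_self ℝ τ⟩ : F)
  · exact fun i => ⟨MvPolynomial.X i, by simp⟩
  · exact fun z hz => ramifiedLE_of_finrank_le hτ0 hτ A hfin hz

end FiniteDimensional

section Optimization

theorem hasDerivAt_eval_update {ι : Type*} [DecidableEq ι] (x : ι → ℝ) (i : ι)
    (p : MvPolynomial ι ℝ) (a : ℝ) :
    HasDerivAt (fun t => MvPolynomial.eval (Function.update x i t) p)
      (MvPolynomial.eval (Function.update x i a) (MvPolynomial.pderiv i p)) a := by
  induction p using MvPolynomial.induction_on with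
  | C c => simpa using hasDerivAt_const a c
  | add p q hp hq => simpa using hp.fun_add hq
  | mul_X p j hp =>
    have hX : HasDerivAt (fun t => Function.update x i t j) (Pi.single (M := fun _ => ℝ) i 1 j) a := by
      rcases eq_or_ne j i with rfl | hj
      · simpa using hasDerivAt_id' a
      · simpa [hj] using hasDerivAt_const a (x j)
    have := hp.fun_mul hX
    rw [Derivation.leibniz, MvPolynomial.pderiv_X]
    have e : MvPolynomial.eval (Function.update x i a)
        (Pi.single (M := fun _ => MvPolynomial ι ℝ) i 1 j) = Pi.single (M := fun _ => ℝ) i 1 j := by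
      rcases eq_or_ne j i with rfl | hj
      · simp
      · simp [hj]
    simp only [smul_eq_mul, map_add, map_mul, MvPolynomial.eval_X, e]
    exact this.congr_deriv (by ring)

theorem hasDerivAt_min_sq (y : ℝ) :
    HasDerivAt (fun y : ℝ => (min y 0) ^ 2) (2 * min y 0) y := by
  rcases lt_trichotomy y 0 with hy | rfl | hy
  · refine HasDerivAt.congr_of_eventuallyEq (f := fun y : ℝ => y ^ 2) ?_ ?_
    · simpa [min_eq_left hy.le] using hasDerivAt_pow 2 y
    · filter_upwards [eventually_lt_nhds hy] with z hz
      rw [min_eq_left hz.le]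
  · rw [hasDerivAt_iff_isLittleO]
    have h : (fun x : ℝ => (min x 0) ^ 2) =O[nhds 0] fun x : ℝ => x ^ 2 := by
      refine Asymptotics.IsBigO.of_bound 1 (Filter.Eventually.of_forall fun x => ?_)
      rw [one_mul, norm_pow, norm_pow]
      refine pow_le_pow_left₀ (norm_nonneg _) ?_ 2
      rcases le_total x 0 with hx | hx
      · rw [min_eq_left hx]
      · rw [min_eq_right hx]; simp
    simpa using h.trans_isLittleO (Asymptotics.isLittleO_pow_id (one_lt_two))
  · refine HasDerivAt.congr_of_eventuallyEq (f := fun _ : ℝ => 0) ?_ ?_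
    · simpa [min_eq_right hy.le] using hasDerivAt_const y (0 : ℝ)
    · filter_upwards [eventually_gt_nhds hy] with z hz
      simp [min_eq_right hz.le]

variable {ι γ : Type*} [Fintype ι] [Fintype γ]

/-- Objective with quadratic penalties for the constraints `0 ≤ g c + b c`. -/
noncomputable def penalized (h : MvPolynomial ι ℝ) (g : γ → MvPolynomial ι ℝ) (b : γ → ℝ)
    (W V : ℝ) (D : ℕ) (x : ι → ℝ) : ℝ :=
  MvPolynomial.eval x h + W * ∑ c, (min (MvPolynomial.eval x (g c) + b c) 0) ^ 2 +
    V * ∑ i, x i ^ (D + 1)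

theorem exists_penalized_min (h : MvPolynomial ι ℝ) (g : γ → MvPolynomial ι ℝ) (b : γ → ℝ)
    (W V : ℝ) (D : ℕ) {lo hi : ι → ℝ} (hlohi : lo ≤ hi) :
    ∃ x ∈ Set.Icc lo hi,
      (∀ y ∈ Set.Icc lo hi, penalized h g b W V D x ≤ penalized h g b W V D y) ∧
      ∀ i, x i = lo i ∨ x i = hi i ∨
        MvPolynomial.eval x (MvPolynomial.pderiv i h) +
          W * ∑ c, 2 * min (MvPolynomial.eval x (g c) + b c) 0 *
            MvPolynomial.eval x (MvPolynomial.pderiv i (g c)) + V * ((D + 1) * x i ^ D) = 0 := by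
  classical
  have hcont : Continuous (penalized h g b W V D) := by
    unfold penalized
    have := fun p : MvPolynomial ι ℝ => MvPolynomial.continuous_eval p
    fun_prop
  obtain ⟨x, hx, hmin⟩ := isCompact_Icc.exists_isMinOn (Set.nonempty_Icc.mpr hlohi)
    hcont.continuousOn
  refine ⟨x, hx, fun y hy => hmin hy, fun i => ?_⟩
  rcases (hx.1 i).eq_or_lt with h1 | h1
  · exact Or.inl h1.symm
  rcases (hx.2 i).eq_or_lt with h2 | h2
  · exact Or.inr (Or.inl h2)
  refine Or.inr (Or.inr ?_)
  have hderiv : HasDerivAt (fun t => penalized h g b W V D (Function.update x i t))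
      (MvPolynomial.eval x (MvPolynomial.pderiv i h) +
          W * ∑ c, 2 * min (MvPolynomial.eval x (g c) + b c) 0 *
            MvPolynomial.eval x (MvPolynomial.pderiv i (g c)) + V * ((D + 1) * x i ^ D)) (x i) := by
    have hself : Function.update x i (x i) = x := Function.update_eq_self i x
    refine ((?_ : HasDerivAt _ _ _).add (HasDerivAt.const_mul W (HasDerivAt.fun_sum fun c _ => ?_))).add
      (HasDerivAt.const_mul V ?_)
    · simpa only [hself] using hasDerivAt_eval_update x i h (x i)
    · have h1 := (hasDerivAt_eval_update x i (g c) (x i)).add_const (b c)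
      have h2 := (hasDerivAt_min_sq
        (MvPolynomial.eval (Function.update x i (x i)) (g c) + b c)).comp (x i) h1
      simpa only [hself, Function.comp_def] using h2
    · have : ∀ t, ∑ j, Function.update x i t j ^ (D + 1) =
          t ^ (D + 1) + ∑ j ∈ Finset.univ.erase i, x j ^ (D + 1) := by
        intro t
        rw [← Finset.add_sum_erase _ _ (Finset.mem_univ i), Function.update_self]
        congr 1
        refine Finset.sum_congr rfl fun j hj => ?_
        rw [Function.update_of_ne (Finset.ne_of_mem_erase hj)]
      simp only [this]
      simpa using (hasDerivAt_pow (D + 1) (x i)).add_const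
        (∑ j ∈ Finset.univ.erase i, x j ^ (D + 1))
  refine IsLocalMin.hasDerivAt_eq_zero ?_ hderiv
  filter_upwards [eventually_gt_nhds h1, eventually_lt_nhds h2] with t ht1 ht2
  rw [Function.update_eq_self]
  refine hmin ⟨fun j => ?_, fun j => ?_⟩
  · rcases eq_or_ne j i with rfl | hj
    · simpa using ht1.le
    · simpa [hj] using hx.1 j
  · rcases eq_or_ne j i with rfl | hj
    · simpa using ht2.le
    · simpa [hj] using hx.2 j

end Optimization

section Hyperreals

open ArchimedeanClass Filter Hyperreal

noncomputable instance : Algebra ℝ ℝ* := Hyperreal.coeRingHom.toRingHom.toAlgebra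

/-- The class of a real sequence in the hyperreals, as an algebra homomorphism. -/
noncomputable def seqHom : (ℕ → ℝ) →ₐ[ℝ] ℝ* where
  toFun := ofSeq
  map_one' := rfl
  map_mul' _ _ := rfl
  map_zero' := rfl
  map_add' _ _ := rfl
  commutes' _ := rfl

theorem seqHom_surjective : Function.Surjective seqHom := ofSeq_surjective

theorem seqHom_le_iff {f g : ℕ → ℝ} : seqHom f ≤ seqHom g ↔ ∀ᶠ k in hyperfilter ℕ, f k ≤ g k :=
  ofSeq_le_ofSeq

theorem seqHom_lt_iff {f g : ℕ → ℝ} : seqHom f < seqHom g ↔ ∀ᶠ k in hyperfilter ℕ, f k < g k :=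
  ofSeq_lt_ofSeq

theorem seqHom_eq_iff {f g : ℕ → ℝ} : seqHom f = seqHom g ↔ ∀ᶠ k in hyperfilter ℕ, f k = g k :=
  Germ.coe_eq

theorem seqHom_const (r : ℝ) : seqHom (fun _ => r) = algebraMap ℝ ℝ* r := rfl

theorem seqHom_inv (f : ℕ → ℝ) : seqHom (fun k => (f k)⁻¹) = (seqHom f)⁻¹ := rfl

theorem seqHom_min_zero (f : ℕ → ℝ) : seqHom (fun k => min (f k) 0) = min (seqHom f) 0 := by
  rcases le_total (seqHom f) 0 with h | h
  · rw [min_eq_left h]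
    rw [← map_zero seqHom, seqHom_le_iff] at h
    exact seqHom_eq_iff.mpr (h.mono fun k hk => min_eq_left hk)
  · rw [min_eq_right h, ← map_zero seqHom]
    rw [← map_zero seqHom, seqHom_le_iff] at h
    exact seqHom_eq_iff.mpr (h.mono fun k hk => min_eq_right hk)

theorem seqHom_eval {ι : Type*} (x : ι → ℕ → ℝ) (p : MvPolynomial ι ℝ) :
    seqHom (fun k => MvPolynomial.eval (fun i => x i k) p) =
      MvPolynomial.aeval (fun i => seqHom (x i)) p := by
  rw [← MvPolynomial.comp_aeval_apply]
  congr 1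
  funext k
  have := MvPolynomial.comp_aeval_apply x (Pi.evalAlgHom ℝ (fun _ : ℕ => ℝ) k) p
  rw [Pi.evalAlgHom_apply] at this
  rw [this]
  rfl

theorem mk_seqHom_pos_of_tendsto {f : ℕ → ℝ} (hf : Tendsto f atTop (nhds 0)) :
    0 < mk (seqHom f) := by
  refine archimedeanClassMk_pos_of_tendsto ?_
  exact hf.mono_left Nat.hyperfilter_le_atTop

end Hyperreals

section Degree

open MvPolynomial

theorem totalDegree_pderiv_le {ι R : Type*} [CommSemiring R] (i : ι) {p : MvPolynomial ι R}
    {n : ℕ} (hp : p.totalDegree ≤ n) : (pderiv i p).totalDegree ≤ n - 1 := by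
  classical
  rw [p.as_sum, map_sum]
  refine totalDegree_finsetSum_le fun m hm => ?_
  rw [pderiv_monomial]
  rcases Nat.eq_zero_or_pos (m i) with h | h
  · simp [h]
  · have h1 : Finsupp.single i 1 ≤ m := by simpa using Nat.succ_le_of_lt h
    have h2 : (m - Finsupp.single i 1).degree + 1 = m.degree := by
      conv_rhs => rw [← tsub_add_cancel_of_le h1, map_add, Finsupp.degree_single]
    have h3 : m.degree ≤ n := (le_totalDegree hm).trans hp
    refine (totalDegree_monomial_le _ _).trans ?_
    change (m - Finsupp.single i 1).degree ≤ _
    omega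

theorem totalDegree_map_le {ι R R' : Type*} [CommSemiring R] [CommSemiring R'] (f : R →+* R')
    (p : MvPolynomial ι R) : (map f p).totalDegree ≤ p.totalDegree :=
  Finset.sup_mono (support_map_subset f p)

end Degree

section BoundedRamification

open MvPolynomial in
theorem exists_pow_eq_aeval_of_stationary {F K ι γ : Type*} [Fintype γ] [Field F] [Field K]
    [CharZero F] [Algebra ℝ F] [Algebra F K] [Algebra ℝ K] [IsScalarTower ℝ F K] {d : ℕ}
    (hd : 1 ≤ d) {g : γ → MvPolynomial ι ℝ} (hg : ∀ c, (g c).totalDegree ≤ d)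
    {h : MvPolynomial ι ℝ} (hh : h.totalDegree ≤ 2 * d) {x : ι → K} {i : ι} {W V : F} (hV : V ≠ 0)
    {b : γ → F} {n : γ → K}
    (hn : ∀ c, n c = aeval x (g c) + algebraMap F K (b c) ∨ n c = 0)
    (heq : aeval x (pderiv i h) + algebraMap F K W * ∑ c, 2 * n c * aeval x (pderiv i (g c)) +
      algebraMap F K V * (((2 * d : ℕ) + 1) * x i ^ (2 * d)) = 0) :
    ∃ q : MvPolynomial ι F, q.totalDegree < 2 * d ∧ x i ^ (2 * d) = aeval x q := by
  have hN : ∀ c, ∃ p : MvPolynomial ι F, p.totalDegree ≤ d ∧ aeval x p = n c := by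
    intro c
    rcases hn c with hc | hc
    · refine ⟨map (algebraMap ℝ F) (g c) + C (b c), ?_, by simp [hc, aeval_map_algebraMap]⟩
      refine (totalDegree_add _ _).trans (max_le ((totalDegree_map_le _ _).trans (hg c)) ?_)
      rw [totalDegree_C]
      exact Nat.zero_le _
    · exact ⟨0, by simp, by simp [hc]⟩
  choose p hp hpn using hN
  have hdeg : ∀ {f : MvPolynomial ι ℝ} {m : ℕ}, f.totalDegree ≤ m →
      (map (algebraMap ℝ F) (pderiv i f)).totalDegree ≤ m - 1 := fun hf =>
    (totalDegree_map_le _ _).trans (totalDegree_pderiv_le i hf)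
  have hC : ∀ (a : F) {f : MvPolynomial ι F} {m : ℕ}, f.totalDegree ≤ m →
      (C a * f).totalDegree ≤ m := by
    intro a f m hf
    refine (totalDegree_mul _ _).trans ?_
    rwa [totalDegree_C, zero_add]
  have hD0 : (((2 * d : ℕ) : F) + 1) ≠ 0 := by
    exact Nat.cast_add_one_ne_zero _
  refine ⟨C (-(V * ((2 * d : ℕ) + 1))⁻¹) * (map (algebraMap ℝ F) (pderiv i h) +
    C W * ∑ c, (C 2 * p c) * map (algebraMap ℝ F) (pderiv i (g c))), ?_, ?_⟩
  · refine lt_of_le_of_lt (hC _ (m := 2 * d - 1) ?_) (by omega)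
    refine (totalDegree_add _ _).trans (max_le (hdeg hh) (hC _ (totalDegree_finsetSum_le
      fun c _ => ?_)))
    refine (totalDegree_mul _ _).trans ?_
    have h1 := hC 2 (hp c)
    have h2 := hdeg (hg c)
    omega
  · have hV' : algebraMap F K V ≠ 0 := by simpa using hV
    have hD' : (((2 * d : ℕ) : K) + 1) ≠ 0 := by
      rw [← map_natCast (algebraMap F K), ← map_one (algebraMap F K), ← map_add]
      exact (map_ne_zero _).mpr hD0
    simp only [map_mul, map_add, map_neg, map_inv₀, map_sum, aeval_C, aeval_map_algebraMap, hpn,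
      map_natCast, map_one, map_ofNat]
    field_simp
    linear_combination heq

open ArchimedeanClass

theorem exists_abs_le_of_mk_nonneg {K : Type*} [Field K] [LinearOrder K] [IsStrictOrderedRing K]
    {x : K} (hx : 0 ≤ mk x) : ∃ n : ℕ, |x| ≤ n := by
  rw [← mk_one (R := K), mk_le_mk] at hx
  simpa using hx

theorem mk_nonneg_of_mem_Icc {K : Type*} [Field K] [LinearOrder K] [IsStrictOrderedRing K]
    [Algebra ℝ K] {x : K} {a b : ℝ} (ha : algebraMap ℝ K a ≤ x) (hb : x ≤ algebraMap ℝ K b) :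
    0 ≤ mk x := by
  rcases le_total 0 x with h | h
  · exact (mk_algebraMap_real_nonneg b).trans (mk_antitoneOn h (h.trans hb) hb)
  · exact (mk_algebraMap_real_nonneg a).trans (mk_monotoneOn (ha.trans h) h ha)

theorem mk_ge_of_sq_le {K : Type*} [Field K] [LinearOrder K] [IsStrictOrderedRing K]
    {x y r : K} (hr : 0 ≤ mk r) (h : x ^ 2 ≤ y ^ 2 * r) : mk y ≤ mk x := by
  obtain ⟨n, hn⟩ := exists_abs_le_of_mk_nonneg hr
  rw [mk_le_mk]
  refine ⟨n + 1, ?_⟩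
  have h1 : |x| ^ 2 ≤ ((n + 1 : ℕ) * |y|) ^ 2 := by
    have h2 : y ^ 2 * r ≤ y ^ 2 * ((n + 1 : ℕ) : K) ^ 2 := by
      refine mul_le_mul_of_nonneg_left ?_ (sq_nonneg y)
      push_cast
      nlinarith [le_abs_self r, Nat.cast_nonneg (α := K) n]
    rw [sq_abs, mul_pow, sq_abs]
    linarith
  rw [nsmul_eq_mul]
  exact le_of_sq_le_sq h1 (by positivity)

open Hyperreal in
/-- A point satisfying polynomial constraints up to an infinitesimal `τ` can be replaced by one with
coordinates in a field of bounded ramification over the powers of `τ`, which satisfies the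
constraints up to order `τ ^ M` and does not increase the objective `h` up to order `τ ^ (2 * M)`. -/
theorem exists_bounded_ramification {ι γ : Type*} [Fintype ι] [Fintype γ] {d : ℕ} (hd : 1 ≤ d)
    {g : γ → MvPolynomial ι ℝ} (hg : ∀ c, (g c).totalDegree ≤ d) (a : γ → ℝ)
    {h : MvPolynomial ι ℝ} (hh : h.totalDegree ≤ 2 * d) {lo hi : ι → ℝ} (M : ℕ) {τ : ℝ*}
    (hτ0 : 0 < τ) (hτ : 0 < mk τ) {x₀ : ι → ℝ*}
    (hbox : ∀ i, algebraMap ℝ ℝ* (lo i) ≤ x₀ i ∧ x₀ i ≤ algebraMap ℝ ℝ* (hi i))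
    (hfeas : ∀ c, 0 ≤ MvPolynomial.aeval x₀ (g c) + a c • τ) :
    ∃ x : ι → ℝ*, (∀ i, algebraMap ℝ ℝ* (lo i) ≤ x i ∧ x i ≤ algebraMap ℝ ℝ* (hi i)) ∧
      (∃ L : IntermediateField ℝ ℝ*, τ ∈ L ∧ (∀ i, x i ∈ L) ∧
        ∀ z ∈ L, RamifiedLE τ ((2 * d) ^ Fintype.card ι) z) ∧
      (∀ c, ∃ v, M • mk τ ≤ mk v ∧ v ≤ MvPolynomial.aeval x (g c) + a c • τ) ∧
      ∃ v, (2 * M) • mk τ ≤ mk v ∧ MvPolynomial.aeval x h ≤ MvPolynomial.aeval x₀ h + v := by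
  obtain ⟨τs, rfl⟩ := seqHom_surjective τ
  choose xs₀ hxs₀ using fun i => seqHom_surjective (x₀ i)
  obtain rfl : (fun i => seqHom (xs₀ i)) = x₀ := funext hxs₀
  have hlohi : lo ≤ hi := by
    intro i
    have := (hbox i).1.trans (hbox i).2
    exact le_of_not_gt fun hlt => absurd this (not_le.mpr (by
      have := algebraMap_pos_real (K := ℝ*) (sub_pos.mpr hlt)
      rw [map_sub] at this
      linarith))
  choose ys hys hmin hstat using fun k => exists_penalized_min h g (fun c => a c * τs k)
    (τs k ^ (2 * M))⁻¹ (τs k ^ (2 * M)) (2 * d) hlohi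
  set xs : ι → ℕ → ℝ := fun i k => ys k i with hxs
  set x : ι → ℝ* := fun i => seqHom (xs i) with hx
  set τ := seqHom τs with hτdef
  have hxbox : ∀ i, algebraMap ℝ ℝ* (lo i) ≤ x i ∧ x i ≤ algebraMap ℝ ℝ* (hi i) := by
    intro i
    rw [← seqHom_const, ← seqHom_const]
    exact ⟨seqHom_le_iff.mpr (.of_forall fun k => (hys k).1 i),
      seqHom_le_iff.mpr (.of_forall fun k => (hys k).2 i)⟩
  set V : ℝ* := τ ^ (2 * M) with hV
  have hVpos : 0 < V := pow_pos hτ0 _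
  have hpen : ∀ zs : ι → ℕ → ℝ, seqHom (fun k => penalized h g (fun c => a c * τs k)
      (τs k ^ (2 * M))⁻¹ (τs k ^ (2 * M)) (2 * d) (fun i => zs i k)) =
      MvPolynomial.aeval (fun i => seqHom (zs i)) h +
      V⁻¹ * ∑ c, (min (MvPolynomial.aeval (fun i => seqHom (zs i)) (g c) + a c • τ) 0) ^ 2 +
        V * ∑ i, seqHom (zs i) ^ (2 * d + 1) := by
    intro zs
    simp only [← seqHom_eval, hV, hτdef, ← map_smul, ← map_add, ← map_pow, ← seqHom_min_zero,
      ← seqHom_inv, ← map_mul, ← map_sum]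
    congr 1
    funext k
    simp [penalized]
  have hle : MvPolynomial.aeval x h +
      V⁻¹ * ∑ c, (min (MvPolynomial.aeval x (g c) + a c • τ) 0) ^ 2 + V * ∑ i, x i ^ (2 * d + 1) ≤
      MvPolynomial.aeval (fun i => seqHom (xs₀ i)) h + V * ∑ i, seqHom (xs₀ i) ^ (2 * d + 1) := by
    have h0 := hpen xs₀
    rw [Finset.sum_eq_zero (fun c _ => by rw [min_eq_right (hfeas c)]; simp), mul_zero,
      add_zero] at h0
    rw [← h0, hx, ← hpen xs, seqHom_le_iff]
    have : ∀ᶠ k in Filter.hyperfilter ℕ, ∀ i, lo i ≤ xs₀ i k ∧ xs₀ i k ≤ hi i := by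
      rw [Filter.eventually_all]
      intro i
      have hi := hbox i
      rw [← seqHom_const, ← seqHom_const, seqHom_le_iff, seqHom_le_iff] at hi
      exact hi.1.and hi.2
    filter_upwards [this] with k hk
    exact hmin k _ ⟨fun i => (hk i).1, fun i => (hk i).2⟩
  have hfin : ∀ z : ι → ℝ*, (∀ i, algebraMap ℝ ℝ* (lo i) ≤ z i ∧ z i ≤ algebraMap ℝ ℝ* (hi i)) →
      0 ≤ mk (MvPolynomial.aeval z h) ∧ 0 ≤ mk (∑ i, z i ^ (2 * d + 1)) := by
    intro z hz
    have h1 : ∀ i, 0 ≤ mk (z i) := fun i => mk_nonneg_of_mem_Icc (hz i).1 (hz i).2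
    refine ⟨mk_aeval_nonneg _ h1, mk_sum_ge _ fun i _ => ?_⟩
    rw [mk_pow]
    exact nsmul_nonneg (h1 i) _
  obtain ⟨hfx, hsx⟩ := hfin x hxbox
  obtain ⟨hfx₀, hsx₀⟩ := hfin _ hbox
  refine ⟨x, hxbox, ?_, fun c => ?_, ?_⟩
  · set F := IntermediateField.adjoin ℝ {τ}
    have hτF : τ ∈ F := IntermediateField.mem_adjoin_simple_self ℝ τ
    have hVF : V ∈ F := pow_mem hτF _
    have hq : ∀ i, ∃ q : MvPolynomial ι F, q.totalDegree < 2 * d ∧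
        x i ^ (2 * d) = MvPolynomial.aeval x q := by
      intro i
      have hconst : ∀ r : ℝ, x i = algebraMap ℝ ℝ* r → ∃ q : MvPolynomial ι F,
          q.totalDegree < 2 * d ∧ x i ^ (2 * d) = MvPolynomial.aeval x q := by
        intro r hr
        refine ⟨MvPolynomial.C (algebraMap ℝ F r ^ (2 * d)), ?_, ?_⟩
        · rw [MvPolynomial.totalDegree_C]
          omega
        · rw [hr, MvPolynomial.aeval_C, map_pow]
          rfl
      have hev : ∀ᶠ k in Filter.hyperfilter ℕ, _ := .of_forall fun k => hstat k i
      rcases Ultrafilter.eventually_or.mp hev with hev | hev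
      · exact hconst (lo i) (seqHom_eq_iff.mpr hev)
      rcases Ultrafilter.eventually_or.mp hev with hev | hev
      · exact hconst (hi i) (seqHom_eq_iff.mpr hev)
      refine exists_pow_eq_aeval_of_stationary hd hg hh (x := x) (i := i) (W := (⟨V, hVF⟩ : F)⁻¹)
        (V := ⟨V, hVF⟩) (b := fun c => a c • ⟨τ, hτF⟩)
        (n := fun c => min (MvPolynomial.aeval x (g c) + a c • τ) 0) ?_ ?_ ?_
      · exact fun h0 => hVpos.ne' (congrArg Subtype.val h0)
      · exact fun c => min_choice _ _
      · have := seqHom_eq_iff (g := 0) |>.mpr hev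
        rw [map_zero] at this
        refine Eq.trans ?_ this
        change _ + V⁻¹ * _ + V * _ = _
        have h2 : (2 : ℝ*) = seqHom 2 := rfl
        have h3 : (((2 * d : ℕ) : ℝ*) + 1) = seqHom (((2 * d : ℕ) : ℕ → ℝ) + 1) := by
          rw [map_add, map_natCast, map_one]
        rw [h3, h2]
        simp only [hx, ← seqHom_eval, hV, hτdef, ← map_smul, ← map_add, ← map_pow,
          ← seqHom_min_zero, ← seqHom_inv, ← map_mul, ← map_sum]
        congr 1
        funext k
        simp [hxs]
    choose q hqd hq using hq
    exact exists_field_ramifiedLE hτ0.ne' hτ hqd hq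
  · refine ⟨min (MvPolynomial.aeval x (g c) + a c • τ) 0, ?_, min_le_left _ _⟩
    rw [← mk_pow]
    refine mk_ge_of_sq_le (r := MvPolynomial.aeval (fun i => seqHom (xs₀ i)) h -
      MvPolynomial.aeval x h + V * (∑ i, seqHom (xs₀ i) ^ (2 * d + 1) - ∑ i, x i ^ (2 * d + 1)))
      ?_ ?_
    · refine mk_add_ge (mk_sub_ge hfx₀ hfx) (mk_mul_ge_left ?_ (mk_sub_ge hsx₀ hsx))
      rw [hV, mk_pow]
      exact nsmul_nonneg hτ.le _
    · have h1 : (min (MvPolynomial.aeval x (g c) + a c • τ) 0) ^ 2 ≤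
          ∑ c, (min (MvPolynomial.aeval x (g c) + a c • τ) 0) ^ 2 :=
        Finset.single_le_sum (f := fun c => (min (MvPolynomial.aeval x (g c) + a c • τ) 0) ^ 2)
          (fun c _ => sq_nonneg _) (Finset.mem_univ c)
      refine h1.trans ?_
      rw [← pow_mul, mul_comm M 2, ← hV, ← inv_mul_le_iff₀ hVpos]
      linarith
  · refine ⟨V * (∑ i, seqHom (xs₀ i) ^ (2 * d + 1) - ∑ i, x i ^ (2 * d + 1)), ?_, ?_⟩
    · refine mk_mul_ge_right (x := V) (by rw [hV, mk_pow]) (mk_sub_ge hsx₀ hsx)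
    · have h1 : 0 ≤ V⁻¹ * ∑ c, (min (MvPolynomial.aeval x (g c) + a c • τ) 0) ^ 2 :=
        mul_nonneg (inv_nonneg.mpr hVpos.le) (Finset.sum_nonneg fun c _ => sq_nonneg _)
      linarith

end BoundedRamification

section Game

variable {S : Fin N → Type}

theorem combine_eq_piSplitAt_symm (n : Fin N) (sn : S n)
    (so : ∀ m : {m : Fin N // m ≠ n}, S m.val) :
    combine n sn so = (Equiv.piSplitAt n S).symm (sn, so) := by
  funext m
  by_cases h : m = n
  · subst h
    simp [combine]
  · simp [combine, h]

theorem combine_self (n : Fin N) (sn : S n) (so : ∀ m : {m : Fin N // m ≠ n}, S m.val) :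
    combine n sn so n = sn := by
  simp [combine]

theorem combine_of_ne (n : Fin N) (sn : S n) (so : ∀ m : {m : Fin N // m ≠ n}, S m.val)
    (m : {m : Fin N // m ≠ n}) : combine n sn so m.val = so m := by
  simp [combine, m.2]

variable [∀ n, Fintype (S n)]

open MvPolynomial in
/-- Player `n`'s payoff from `u`, as a polynomial in the strategies of the other players. -/
noncomputable def replyPoly (G : Fin N → (∀ m, S m) → ℝ) (n : Fin N) (u : S n → ℝ) :
    MvPolynomial (Σ m, S m) ℝ :=
  ∑ so : ∀ m : {m : Fin N // m ≠ n}, S m.val,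
    (∏ m : {m : Fin N // m ≠ n}, X ⟨m.val, so m⟩) * C (∑ sn, u sn * G n (combine n sn so))

theorem totalDegree_replyPoly_le (G : Fin N → (∀ m, S m) → ℝ) (n : Fin N) (u : S n → ℝ) :
    (replyPoly G n u).totalDegree ≤ N - 1 := by
  refine MvPolynomial.totalDegree_finsetSum_le fun so _ => ?_
  refine (MvPolynomial.totalDegree_mul _ _).trans ?_
  rw [MvPolynomial.totalDegree_C, add_zero]
  refine (MvPolynomial.totalDegree_finsetProd _ _).trans ?_
  simp [MvPolynomial.totalDegree_X]

theorem payoff_update (G : Fin N → (∀ m, S m) → ℝ) (n : Fin N) (τ : Profile S) (u : S n → ℝ) :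
    payoff G n (Function.update τ n u) =
      MvPolynomial.eval (fun p : Σ m, S m => τ p.1 p.2) (replyPoly G n u) := by
  unfold payoff replyPoly
  rw [← (Equiv.piSplitAt n S).symm.sum_comp, Fintype.sum_prod_type, Finset.sum_comm, map_sum]
  refine Finset.sum_congr rfl fun so _ => ?_
  rw [map_mul, MvPolynomial.eval_C, map_prod, Finset.mul_sum]
  refine Finset.sum_congr rfl fun sn _ => ?_
  rw [← combine_eq_piSplitAt_symm, Fintype.prod_eq_mul_prod_subtype_ne _ n, Function.update_self,
    combine_self]
  simp only [MvPolynomial.eval_X, combine_of_ne]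
  have : ∀ m : {m : Fin N // m ≠ n}, Function.update τ n u m.val = τ m.val := fun m =>
    Function.update_of_ne m.2 _ _
  simp only [this]
  ring

theorem replyPoly_sub (G : Fin N → (∀ m, S m) → ℝ) (n : Fin N) (u w : S n → ℝ) :
    replyPoly G n (u - w) = replyPoly G n u - replyPoly G n w := by
  unfold replyPoly
  rw [← Finset.sum_sub_distrib]
  refine Finset.sum_congr rfl fun so _ => ?_
  rw [← mul_sub, ← map_sub, ← Finset.sum_sub_distrib]
  simp [sub_mul]

theorem aeval_replyPoly {A : Type*} [CommRing A] [Algebra ℝ A] (G : Fin N → (∀ m, S m) → ℝ)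
    (n : Fin N) (u : S n → ℝ) (x : (Σ m, S m) → A) :
    MvPolynomial.aeval x (replyPoly G n u) = ∑ so : ∀ m : {m : Fin N // m ≠ n}, S m.val,
      (∏ m : {m : Fin N // m ≠ n}, x ⟨m.val, so m⟩) *
        algebraMap ℝ A (∑ sn, u sn * G n (combine n sn so)) := by
  simp [replyPoly, map_sum, map_mul, map_prod]

theorem aeval_replyPoly_smul {A : Type*} [CommRing A] [Algebra ℝ A] (G : Fin N → (∀ m, S m) → ℝ)
    (n : Fin N) (u : S n → ℝ) (x : (Σ m, S m) → A) (a : Fin N → A) :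
    MvPolynomial.aeval (fun p => a p.1 * x p) (replyPoly G n u) =
      (∏ m : {m : Fin N // m ≠ n}, a m.val) * MvPolynomial.aeval x (replyPoly G n u) := by
  rw [aeval_replyPoly, aeval_replyPoly, Finset.mul_sum]
  refine Finset.sum_congr rfl fun so _ => ?_
  rw [Finset.prod_mul_distrib, mul_assoc]

theorem beliefPayoff_eq (G : Fin N → (∀ m, S m) → ℝ) (n : Fin N) (u : S n → ℝ)
    (μ : (∀ m : {m : Fin N // m ≠ n}, S m.val) → ℝ) :
    beliefPayoff G n u μ = ∑ so : ∀ m : {m : Fin N // m ≠ n}, S m.val,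
      μ so * ∑ sn, u sn * G n (combine n sn so) := by
  unfold beliefPayoff
  refine Finset.sum_congr rfl fun so _ => ?_
  rw [Finset.mul_sum]
  refine Finset.sum_congr rfl fun sn _ => ?_
  ring

theorem aeval_replyPoly_lps {A : Type*} [CommRing A] [Algebra ℝ A] (G : Fin N → (∀ m, S m) → ℝ)
    (n : Fin N) (u : S n → ℝ) {K : ℕ} (ϱ : ∀ n, Fin (K + 1) → S n → ℝ) (t : A) :
    MvPolynomial.aeval (fun p : Σ m, S m => ∑ k, algebraMap ℝ A (ϱ p.1 k p.2) * t ^ (k : ℕ))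
      (replyPoly G n u) = ∑ j ∈ Finset.range ((N - 1) * K + 1),
        algebraMap ℝ A (beliefPayoff G n u (ubelief ϱ n j)) * t ^ j := by
  rw [aeval_replyPoly]
  simp only [beliefPayoff_eq, map_sum (algebraMap ℝ A), Finset.sum_mul]
  rw [Finset.sum_comm]
  refine Finset.sum_congr rfl fun so _ => ?_
  rw [Finset.prod_univ_sum, Fintype.piFinset_univ]
  have hmaps : ∀ kv ∈ (Finset.univ : Finset ({m : Fin N // m ≠ n} → Fin (K + 1))),
      ∑ m, (kv m : ℕ) ∈ Finset.range ((N - 1) * K + 1) := by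
    intro kv _
    rw [Finset.mem_range, Nat.lt_succ_iff]
    refine (Finset.sum_le_card_nsmul _ _ K fun m _ => Nat.lt_succ_iff.mp (kv m).2).trans ?_
    simp
  rw [← Finset.sum_fiberwise_of_maps_to hmaps, Finset.sum_mul]
  refine Finset.sum_congr rfl fun j _ => ?_
  rw [map_mul, ubelief, map_sum, Finset.sum_mul, Finset.sum_mul, Finset.sum_mul]
  refine Finset.sum_congr rfl fun kv hkv => ?_
  rw [Finset.prod_mul_distrib, Finset.prod_pow_eq_pow_sum, (Finset.mem_filter.mp hkv).2, map_prod,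
    map_sum]
  ring

theorem sum_ubelief_pos (hN : 2 ≤ N) {K : ℕ} {ϱ : ∀ n, Fin (K + 1) → S n → ℝ}
    (hϱ : IsLPSProfile ϱ) (n : Fin N) {j : ℕ} (hj : j ≤ K) :
    0 < ∑ so : ∀ m : {m : Fin N // m ≠ n}, S m.val, ubelief ϱ n j so := by
  classical
  unfold ubelief
  rw [Finset.sum_comm]
  have h1 : ∀ kv : {m : Fin N // m ≠ n} → Fin (K + 1),
      ∑ so : ∀ m : {m : Fin N // m ≠ n}, S m.val, ∏ m, ϱ m.val (kv m) (so m) = 1 := by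
    intro kv
    have := Finset.prod_univ_sum (fun m : {m : Fin N // m ≠ n} => (Finset.univ : Finset (S m.val)))
      (fun m s => ϱ m.val (kv m) s)
    rw [Fintype.piFinset_univ] at this
    rw [← this]
    exact Finset.prod_eq_one fun m _ => (hϱ m.val (kv m)).2
  simp only [h1, Finset.sum_const, nsmul_eq_mul, mul_one]
  rw [Nat.cast_pos, Finset.card_pos]
  have : Nontrivial (Fin N) := Fin.nontrivial_iff_two_le.mpr hN
  obtain ⟨m, hm⟩ := exists_ne n
  refine ⟨Pi.single ⟨m, hm⟩ ⟨j, by omega⟩, ?_⟩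
  rw [Finset.mem_filter]
  refine ⟨Finset.mem_univ _, ?_⟩
  rw [Finset.sum_eq_single ⟨m, hm⟩]
  · simp
  · intro b _ hb
    simp [hb]
  · simp

theorem beliefPayoff_belief (G : Fin N → (∀ m, S m) → ℝ) (n : Fin N) (u : S n → ℝ) {K : ℕ}
    (ϱ : ∀ n, Fin (K + 1) → S n → ℝ) (j : ℕ) :
    beliefPayoff G n u (belief ϱ n j) =
      (∑ so : ∀ m : {m : Fin N // m ≠ n}, S m.val, ubelief ϱ n j so)⁻¹ *
        beliefPayoff G n u (ubelief ϱ n j) := by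
  simp only [beliefPayoff_eq, belief, mul_assoc, Finset.mul_sum]

theorem beliefPayoff_sub (G : Fin N → (∀ m, S m) → ℝ) (n : Fin N) (u w : S n → ℝ)
    (μ : (∀ m : {m : Fin N // m ≠ n}, S m.val) → ℝ) :
    beliefPayoff G n (u - w) μ = beliefPayoff G n u μ - beliefPayoff G n w μ := by
  simp only [beliefPayoff_eq, ← Finset.sum_sub_distrib, ← mul_sub, Pi.sub_apply, sub_mul]

theorem lpsBestReply_iff [∀ n, DecidableEq (S n)] (hN : 2 ≤ N) (G : Fin N → (∀ m, S m) → ℝ) {K : ℕ}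
    {ϱ : ∀ n, Fin (K + 1) → S n → ℝ} (hϱ : IsLPSProfile ϱ) (n : Fin N) (u : S n → ℝ) :
    lpsBestReply G ϱ n u K ↔ ∀ s : S n,
      (∀ k < K + 1, beliefPayoff G n (u - pureStrat s) (ubelief ϱ n k) = 0) ∨
      ∃ p < K + 1, (∀ j < p, beliefPayoff G n (u - pureStrat s) (ubelief ϱ n j) = 0) ∧
        0 < beliefPayoff G n (u - pureStrat s) (ubelief ϱ n p) := by
  have hpos : ∀ j < K + 1,
      0 < (∑ so : ∀ m : {m : Fin N // m ≠ n}, S m.val, ubelief ϱ n j so)⁻¹ :=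
    fun j hj => inv_pos.mpr (sum_ubelief_pos hN hϱ n (by omega))
  have heq : ∀ w : S n → ℝ, ∀ j < K + 1, (beliefPayoff G n u (belief ϱ n j) =
      beliefPayoff G n w (belief ϱ n j) ↔ beliefPayoff G n (u - w) (ubelief ϱ n j) = 0) := by
    intro w j hj
    rw [beliefPayoff_belief, beliefPayoff_belief, mul_right_inj' (hpos j hj).ne', beliefPayoff_sub,
      sub_eq_zero]
  have hlt : ∀ w : S n → ℝ, ∀ j < K + 1, (beliefPayoff G n w (belief ϱ n j) <
      beliefPayoff G n u (belief ϱ n j) ↔ 0 < beliefPayoff G n (u - w) (ubelief ϱ n j)) := by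
    intro w j hj
    rw [beliefPayoff_belief, beliefPayoff_belief, mul_lt_mul_iff_right₀ (hpos j hj),
      beliefPayoff_sub, sub_pos]
  refine forall_congr' fun s => or_congr ?_ ?_
  · exact forall_congr' fun j => ⟨fun h hj => (heq _ j hj).mp (h (by omega)),
      fun h hj => (heq _ j (by omega)).mpr (h (by omega))⟩
  · refine exists_congr fun p => ⟨fun ⟨hp, h1, h2⟩ => ⟨by omega, fun j hj =>
      (heq _ j (by omega)).mp (h1 j hj), (hlt _ p (by omega)).mp h2⟩, fun ⟨hp, h1, h2⟩ =>
      ⟨by omega, fun j hj => (heq _ j (by omega)).mpr (h1 j hj), (hlt _ p hp).mpr h2⟩⟩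

end Game

section PartialSums

open Topology

theorem eventually_sum_pow_pos {a : ℕ → ℝ} {e k : ℕ} (hek : e ≤ k) (ha : ∀ j < e, a j = 0)
    (hae : 0 < a e) : ∀ᶠ ε in 𝓝[>] (0 : ℝ), 0 < ∑ j ∈ Finset.range (k + 1), a j * ε ^ j := by
  have hc : Continuous fun ε : ℝ => ∑ j ∈ Finset.range (k - e + 1), a (e + j) * ε ^ j := by
    fun_prop
  have h0 : 0 < ∑ j ∈ Finset.range (k - e + 1), a (e + j) * (0 : ℝ) ^ j := by
    rw [Finset.sum_range_succ']
    simpa using hae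
  have h1 := (hc.tendsto 0).eventually (lt_mem_nhds h0)
  filter_upwards [nhdsWithin_le_nhds h1, self_mem_nhdsWithin] with ε hε hε0
  have hk : k + 1 = e + (k - e + 1) := by omega
  rw [hk, Finset.sum_range_add, Finset.sum_eq_zero, zero_add]
  · have : ∑ j ∈ Finset.range (k - e + 1), a (e + j) * ε ^ (e + j) =
        ε ^ e * ∑ j ∈ Finset.range (k - e + 1), a (e + j) * ε ^ j := by
      rw [Finset.mul_sum]
      exact Finset.sum_congr rfl fun j _ => by ring
    rw [this]
    exact mul_pos (pow_pos hε0 e) hε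
  · intro j hj
    rw [ha j (Finset.mem_range.mp hj), zero_mul]

theorem exists_forall_sum_pow_pos {P : Type*} [Finite P] (K : ℕ) {a : P → ℕ → ℝ} {e : P → ℕ}
    (ha : ∀ p, ∀ j < e p, a p j = 0) (hae : ∀ p, 0 < a p (e p)) :
    ∃ ε : ℝ, 0 < ε ∧ ∀ p, ∀ k ≤ K, e p ≤ k → 0 < ∑ j ∈ Finset.range (k + 1), a p j * ε ^ j := by
  have h : ∀ᶠ ε in 𝓝[>] (0 : ℝ), ∀ p, ∀ k ∈ Set.Iic K, e p ≤ k →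
      0 < ∑ j ∈ Finset.range (k + 1), a p j * ε ^ j := by
    rw [Filter.eventually_all]
    intro p
    rw [Filter.eventually_all_finite (Set.finite_Iic K)]
    intro k _
    by_cases hk : e p ≤ k
    · exact (eventually_sum_pow_pos hk (ha p) (hae p)).mono fun ε h _ => h
    · exact Filter.Eventually.of_forall fun ε h => absurd h hk
  obtain ⟨ε, hε, hε0⟩ := (h.and self_mem_nhdsWithin).exists
  exact ⟨ε, hε0, hε⟩

theorem one_sub_mul_sum_partial_sums {A : Type*} [CommRing A] (c : ℕ → A) (u : A) (K : ℕ) :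
    (1 - u) * ∑ k ∈ Finset.range (K + 1), (∑ i ∈ Finset.range (k + 1), c i) * u ^ k =
      ∑ k ∈ Finset.range (K + 1), c k * u ^ k -
        (∑ i ∈ Finset.range (K + 1), c i) * u ^ (K + 1) := by
  induction K with
  | zero => simp; ring
  | succ K ih =>
    rw [Finset.sum_range_succ, mul_add, ih, Finset.sum_range_succ _ (K + 1),
      Finset.sum_range_succ _ (K + 1)]
    ring

end PartialSums

section Extraction

open ArchimedeanClass

variable {S : Fin N → Type} [∀ n, Fintype (S n)]

/-- Rescaling the expansion of an infinitesimal perturbation and passing to partial sums gives an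
LPS profile. -/
theorem exists_lps_of_expansion {F : Type*} [Field F] [LinearOrder F] [IsStrictOrderedRing F]
    [Algebra ℝ F] {t : F} (ht0 : 0 < t) {K ℓ : ℕ} (hℓK : ℓ ≤ K)
    {y : (Σ n, S n) → F} {a : (Σ n, S n) → ℕ → ℝ}
    (hy : ∀ p, (K + 1) • mk t ≤
      mk (y p - ∑ k ∈ Finset.range (K + 1), algebraMap ℝ F (a p k) * t ^ k))
    (hsum : ∀ n, ∀ k < K + 1, ∑ s : S n, a ⟨n, s⟩ k = if k = 0 then 1 else 0)
    (hpos : ∀ p, ∃ e ≤ ℓ, (∀ j < e, a p j = 0) ∧ 0 < a p e) :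
    ∃ (ϱ : ∀ n, Fin (K + 1) → S n → ℝ) (u : F), IsLPSProfile ϱ ∧ FullSupport ϱ ∧
      lpsLevel ϱ ≤ ℓ ∧ (∀ n s, ϱ n 0 s = a ⟨n, s⟩ 0) ∧ 0 < u ∧ mk u = mk t ∧
      ∀ p : Σ n, S n, (K + 1) • mk t ≤
        mk ((1 - u) * (∑ k, algebraMap ℝ F (ϱ p.1 k p.2) * u ^ (k : ℕ)) - y p) := by
  choose e heℓ hae hepos using hpos
  obtain ⟨ε, hε0, hε⟩ := exists_forall_sum_pow_pos K hae hepos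
  set c : (Σ n, S n) → ℕ → ℝ := fun p j => a p j * ε ^ j with hc
  have hεF : (0 : F) < algebraMap ℝ F ε := algebraMap_pos_real hε0
  have hmk : mk (t / algebraMap ℝ F ε) = mk t := by
    rw [div_eq_mul_inv, ← map_inv₀, mk_mul, mk_algebraMap_real (inv_ne_zero hε0.ne'), add_zero]
  have hℓsupp : ∀ n (s : S n), ∃ i : Fin (K + 1), (i : ℕ) ≤ ℓ ∧
      ∑ j ∈ Finset.range ((i : ℕ) + 1), c ⟨n, s⟩ j ≠ 0 := fun n s =>
    ⟨⟨e ⟨n, s⟩, by have := heℓ ⟨n, s⟩; omega⟩, heℓ ⟨n, s⟩,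
      (hε ⟨n, s⟩ _ ((heℓ _).trans hℓK) le_rfl).ne'⟩
  refine ⟨fun n k s => ∑ j ∈ Finset.range ((k : ℕ) + 1), c ⟨n, s⟩ j, t / algebraMap ℝ F ε,
    ?_, ?_, ?_, ?_, div_pos ht0 hεF, hmk, ?_⟩
  · refine fun n k => ⟨fun s => ?_, ?_⟩
    · rcases le_or_gt (e ⟨n, s⟩) k with h | h
      · exact (hε ⟨n, s⟩ k (Nat.lt_succ_iff.mp k.2) h).le
      · refine (Finset.sum_eq_zero fun j hj => ?_).ge
        simp only [hc]
        rw [hae ⟨n, s⟩ j (by have := Finset.mem_range.mp hj; omega), zero_mul]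
    · rw [Finset.sum_comm]
      have h1 : ∀ j ∈ Finset.range ((k : ℕ) + 1), ∑ s, c ⟨n, s⟩ j = if j = 0 then 1 else 0 := by
        intro j hj
        simp only [hc]
        rw [← Finset.sum_mul, hsum n j (by have := Finset.mem_range.mp hj; omega)]
        split_ifs with h <;> simp [h]
      rw [Finset.sum_congr rfl h1]
      simp
  · exact fun n s => (hℓsupp n s).imp fun i hi => hi.2
  · exact Finset.sup_le fun n _ => Nat.sInf_le (hℓsupp n)
  · intro n s
    simp [hc]
  · intro p
    have hcu : ∀ k, algebraMap ℝ F (c p k) * (t / algebraMap ℝ F ε) ^ k =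
        algebraMap ℝ F (a p k) * t ^ k := by
      intro k
      simp only [hc, map_mul, map_pow]
      rw [mul_assoc, ← mul_pow, mul_div_cancel₀ _ hεF.ne']
    have hsumk := one_sub_mul_sum_partial_sums (fun j => algebraMap ℝ F (c p j))
      (t / algebraMap ℝ F ε) K
    simp only [hcu, ← map_sum] at hsumk
    rw [Fin.sum_univ_eq_sum_range (fun k => algebraMap ℝ F (∑ j ∈ Finset.range (k + 1), c p j) *
      (t / algebraMap ℝ F ε) ^ k), hsumk, sub_right_comm]
    refine mk_sub_ge ?_ ?_
    · rw [mk_sub_comm]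
      exact hy p
    · refine mk_mul_ge_left (mk_algebraMap_real_nonneg _) ?_
      rw [mk_pow, hmk]

theorem lpsBestReply_of_approx [∀ n, DecidableEq (S n)] (hN : 2 ≤ N)
    (G : Fin N → (∀ m, S m) → ℝ) {F : Type*} [Field F] [LinearOrder F] [IsStrictOrderedRing F]
    [Algebra ℝ F] {K : ℕ} {ϱ : ∀ n, Fin (K + 1) → S n → ℝ} (hϱ : IsLPSProfile ϱ) {u : F}
    (hu0 : 0 < u) (hu : 0 < mk u) {y : (Σ n, S n) → F} (hy0 : ∀ p, 0 ≤ mk (y p))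
    (hy : ∀ p : Σ n, S n, (K + 1) • mk u ≤
      mk ((1 - u) * (∑ k, algebraMap ℝ F (ϱ p.1 k p.2) * u ^ (k : ℕ)) - y p))
    (n : Fin N) (w : S n → ℝ)
    (hw : ∀ s, ∃ v, (K + 1) • mk u ≤ mk v ∧
      v ≤ MvPolynomial.aeval y (replyPoly G n (w - pureStrat s))) :
    lpsBestReply G ϱ n w K := by
  rw [lpsBestReply_iff hN G hϱ]
  intro s
  obtain ⟨v, hv, hvy⟩ := hw s
  set f := replyPoly G n (w - pureStrat s) with hf
  set z : (Σ n, S n) → F := fun p => ∑ k, algebraMap ℝ F (ϱ p.1 k p.2) * u ^ (k : ℕ) with hz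
  have h1u : 0 < 1 - u := by
    have := add_pos_of_infinitesimal one_pos (δ := -u) (by rwa [mk_neg])
    rwa [map_one, ← sub_eq_add_neg] at this
  have hmk1u : mk (1 - u) = 0 := by
    rw [mk_sub_eq_mk_left (by rwa [mk_one]), mk_one]
  have hz0 : ∀ p, 0 ≤ mk ((1 - u) * z p) := by
    intro p
    have h1 : (1 - u) * z p = y p + ((1 - u) * z p - y p) := by ring
    rw [h1]
    refine mk_add_ge (hy0 p) ((nsmul_nonneg hu.le _).trans (hy p))
  have hdiff := mk_aeval_sub_ge f hz0 hy0 hy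
  have hscale := aeval_replyPoly_smul G n (w - pureStrat s) z (fun _ => 1 - u)
  rw [Finset.prod_const, ← hf] at hscale
  set D := (1 - u) ^ (Finset.univ : Finset {m : Fin N // m ≠ n}).card with hD
  have hD0 : 0 < D := pow_pos h1u _
  have hmkD : mk D⁻¹ = 0 := by rw [hD, mk_inv, mk_pow, hmk1u, nsmul_zero, neg_zero]
  rw [hscale] at hdiff
  set δ := D * MvPolynomial.aeval z f - MvPolynomial.aeval y f with hδ
  have hle : D⁻¹ * (v + δ) ≤ MvPolynomial.aeval z f := by
    rw [inv_mul_le_iff₀ hD0]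
    linarith
  rw [hf, aeval_replyPoly_lps] at hle
  have hKle : K + 1 ≤ (N - 1) * K + 1 := by
    have : 1 ≤ N - 1 := by omega
    nlinarith
  obtain ⟨r, hr⟩ := Nat.exists_eq_add_of_le hKle
  rw [hr, Finset.sum_range_add, ← sub_le_iff_le_add] at hle
  refine lex_of_infinitesimal_le hu0 hu (mk_sub_ge ?_ ?_) hle
  · exact mk_mul_ge_left hmkD.ge (mk_add_ge hv hdiff)
  · refine mk_sum_ge _ fun i _ => mk_mul_ge_left (mk_algebraMap_real_nonneg _) ?_
    rw [mk_pow]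
    exact nsmul_le_nsmul_left hu.le (by omega)

end Extraction

section Forward

open ArchimedeanClass

variable {S : Fin N → Type} [∀ n, Fintype (S n)]

theorem exists_hyperreal_infinitesimal : ∃ ε : ℝ*, 0 < ε ∧ 0 < mk ε := by
  refine ⟨seqHom fun k => 1 / ((k : ℝ) + 1), ?_,
    mk_seqHom_pos_of_tendsto tendsto_one_div_add_atTop_nhds_zero_nat⟩
  rw [← map_zero seqHom, seqHom_lt_iff]
  exact Filter.Eventually.of_forall fun k => Nat.one_div_pos_of_nat

theorem exists_infinitesimal_le {P : Type*} [Finite P] {x : P → ℝ*} (hx : ∀ p, 0 < x p) :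
    ∃ τ : ℝ*, 0 < τ ∧ 0 < mk τ ∧ ∀ p, τ ≤ x p := by
  obtain ⟨ε, hε0, hε⟩ := exists_hyperreal_infinitesimal
  obtain ⟨q, hq⟩ := Finite.exists_min (fun q : Option P => q.elim ε x)
  have hpos : ∀ q : Option P, 0 < q.elim ε x := by
    rintro (_ | p)
    exacts [hε0, hx p]
  exact ⟨q.elim ε x, hpos q, hε.trans_le (mk_antitoneOn (hpos q).le hε0.le (hq none)),
    fun p => hq (some p)⟩

theorem mk_sum_pos {F ι : Type*} [Field F] [LinearOrder F] [IsStrictOrderedRing F]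
    (s : Finset ι) {f : ι → F} (hf : ∀ i ∈ s, 0 < mk (f i)) : 0 < mk (∑ i ∈ s, f i) :=
  Finset.sum_induction f (fun z => 0 < mk z)
    (fun _ _ ha hb => (lt_min ha hb).trans_le (min_le_mk_add _ _))
    (by simp [mk_zero]) hf

theorem exists_first_coeff_pos {F : Type*} [Field F] [LinearOrder F] [IsStrictOrderedRing F]
    [Algebra ℝ F] {t y : F} (ht0 : 0 < t) (ht : 0 < mk t) {n e : ℕ} (hen : e < n) {c : ℕ → ℝ}
    (hy0 : 0 ≤ y) (hye : mk y ≤ e • mk t)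
    (hy : n • mk t ≤ mk (y - ∑ k ∈ Finset.range n, algebraMap ℝ F (c k) * t ^ k)) :
    ∃ p ≤ e, (∀ j < p, c j = 0) ∧ 0 < c p := by
  have hnot : ¬ (e + 1) • mk t ≤ mk y := fun h => by
    have := (nsmul_mk_le_iff ht0.ne' ht).mp (h.trans hye)
    omega
  have hsum : ¬ (e + 1) • mk t ≤ mk (∑ k ∈ Finset.range n, algebraMap ℝ F (c k) * t ^ k) := by
    intro h
    refine hnot ?_
    have := mk_add_ge ((nsmul_le_nsmul_left ht.le (Nat.succ_le_of_lt hen)).trans hy) h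
    rwa [sub_add_cancel] at this
  rw [mk_sub_comm] at hy
  rcases lex_of_infinitesimal_le ht0 ht hy (sub_le_self _ hy0) with h | ⟨p, hpn, hp, hcp⟩
  · refine absurd ?_ hsum
    rw [Finset.sum_eq_zero fun k hk => by rw [h k (Finset.mem_range.mp hk), map_zero, zero_mul],
      mk_zero]
    exact le_top
  · refine ⟨p, ?_, hp, hcp⟩
    by_contra hpe
    refine hsum ?_
    rw [mk_sum_pow ht c hpn hp hcp.ne']
    exact nsmul_le_nsmul_left ht.le (by omega)

/-- A perfect equilibrium has an infinitesimal perturbation, generating a field of bounded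
ramification, against which it is approximately a best reply. -/
theorem exists_ramified_perturbation [∀ n, DecidableEq (S n)] (hN : 2 ≤ N)
    (G : Fin N → (∀ m, S m) → ℝ) {σ : Profile S} (h : IsPerfect G σ) {M : ℕ} (hM : 2 ≤ M) :
    ∃ (τ : ℝ*) (x : (Σ n, S n) → ℝ*) (L : IntermediateField ℝ ℝ*), 0 < τ ∧ 0 < mk τ ∧ τ ∈ L ∧
      (∀ p, x p ∈ L) ∧ (∀ z ∈ L, RamifiedLE τ ((2 * (N - 1)) ^ Fintype.card (Σ n, S n)) z) ∧
      (∀ p, 0 < mk (x p - algebraMap ℝ ℝ* (σ p.1 p.2))) ∧ (∀ p, 0 < x p ∧ mk (x p) ≤ mk τ) ∧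
      ∀ n s, ∃ v, M • mk τ ≤ mk v ∧
        v ≤ MvPolynomial.aeval x (replyPoly G n (σ n - pureStrat s)) := by
  obtain ⟨σk, hσk, hlim, hbest⟩ := h
  set x₀ : (Σ n, S n) → ℝ* := fun p => seqHom fun k => σk k p.1 p.2 with hx₀
  have hx₀pos : ∀ p, 0 < x₀ p := fun p => by
    rw [hx₀, ← map_zero seqHom, seqHom_lt_iff]
    exact Filter.Eventually.of_forall fun k => (hσk k).2 p.1 p.2
  have hx₀le : ∀ p, x₀ p ≤ 1 := fun p => by
    rw [hx₀, ← map_one seqHom, seqHom_le_iff]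
    refine Filter.Eventually.of_forall fun k => ?_
    rw [Pi.one_apply, ← ((hσk k).1 p.1).2]
    exact Finset.single_le_sum (fun s _ => ((hσk k).1 p.1).1 s) (Finset.mem_univ p.2)
  have hx₀σ : ∀ p, 0 < mk (x₀ p - algebraMap ℝ ℝ* (σ p.1 p.2)) := fun p => by
    rw [hx₀, ← seqHom_const, ← map_sub]
    refine mk_seqHom_pos_of_tendsto ?_
    have := tendsto_pi_nhds.mp (tendsto_pi_nhds.mp hlim p.1) p.2
    rw [← sub_self (σ p.1 p.2)]
    exact this.sub_const (σ p.1 p.2)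
  obtain ⟨τ, hτ0, hτ, hτx⟩ := exists_infinitesimal_le hx₀pos
  set hpoly : MvPolynomial (Σ n, S n) ℝ :=
    ∑ p, (MvPolynomial.X p - MvPolynomial.C (σ p.1 p.2)) ^ 2 with hhpoly
  have haeval : ∀ x : (Σ n, S n) → ℝ*, MvPolynomial.aeval x hpoly =
      ∑ p, (x p - algebraMap ℝ ℝ* (σ p.1 p.2)) ^ 2 := fun x => by
    simp [hhpoly, map_sum]
  have hd : 1 ≤ N - 1 := by omega
  have hdeg : hpoly.totalDegree ≤ 2 * (N - 1) := by
    refine MvPolynomial.totalDegree_finsetSum_le fun p _ => ?_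
    refine (MvPolynomial.totalDegree_pow _ _).trans (Nat.mul_le_mul_left 2 ?_)
    refine (MvPolynomial.totalDegree_sub_C_le _ _).trans ?_
    rwa [MvPolynomial.totalDegree_X]
  obtain ⟨x, hbox, ⟨L, hτL, hxL, hL⟩, hcon, v, hv, hvle⟩ := exists_bounded_ramification hd
    (g := Sum.elim (fun q : Σ n, S n => replyPoly G q.1 (σ q.1 - pureStrat q.2)) MvPolynomial.X)
    (by
      rintro (q | p)
      · exact totalDegree_replyPoly_le G _ _
      · simpa using hd)
    (Sum.elim (fun _ => 0) fun _ => -1) hdeg (lo := fun _ => 0) (hi := fun _ => 1) M hτ0 hτ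
    (x₀ := x₀) (fun p => by simpa using ⟨(hx₀pos p).le, hx₀le p⟩)
    (by
      rintro (q | p)
      · simp only [Sum.elim_inl, zero_smul, add_zero]
        rw [hx₀, ← seqHom_eval, ← map_zero seqHom, seqHom_le_iff]
        refine Filter.Eventually.of_forall fun k => ?_
        have := hbest k q.1 q.2
        rw [payoff_update, payoff_update] at this
        rw [replyPoly_sub, map_sub, Pi.zero_apply, sub_nonneg]
        exact this
      · simpa using hτx p)
  refine ⟨τ, x, L, hτ0, hτ, hτL, hxL, hL, fun p => ?_, fun p => ?_, fun n s => ?_⟩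
  · have h0 : 0 < mk (MvPolynomial.aeval x₀ hpoly + v) := by
      have h1 : mk τ ≤ mk v := by
        refine le_trans ?_ hv
        simpa using nsmul_le_nsmul_left hτ.le (show 1 ≤ 2 * M by omega)
      refine lt_of_lt_of_le (lt_min ?_ (hτ.trans_le h1)) (min_le_mk_add _ _)
      rw [haeval]
      refine mk_sum_pos _ fun p _ => ?_
      rw [sq]
      exact (hx₀σ p).trans_le (mk_mul_ge_left (hx₀σ p).le le_rfl)
    have h1 : (x p - algebraMap ℝ ℝ* (σ p.1 p.2)) ^ 2 ≤ MvPolynomial.aeval x hpoly := by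
      rw [haeval]
      exact Finset.single_le_sum (f := fun p => (x p - algebraMap ℝ ℝ* (σ p.1 p.2)) ^ 2)
        (fun p _ => sq_nonneg _) (Finset.mem_univ p)
    have h2 := mk_antitoneOn (Set.mem_Ici.mpr (sq_nonneg _))
      (Set.mem_Ici.mpr ((sq_nonneg _).trans (h1.trans hvle))) (h1.trans hvle)
    exact pos_mk_of_mk_eq_nsmul (h0.trans_le h2) (mk_pow 2 _)
  · obtain ⟨w, hw, hwle⟩ := hcon (Sum.inr p)
    simp only [Sum.elim_inr, MvPolynomial.aeval_X, neg_smul, one_smul] at hwle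
    have hlt : mk τ < mk w := by
      refine lt_of_lt_of_le (not_le.mp fun h => ?_) hw
      have := (nsmul_mk_le_iff (m := M) (n := 1) hτ0.ne' hτ).mp (by rwa [one_nsmul])
      omega
    have hmk : mk (τ + w) = mk τ := mk_add_eq_mk_left hlt
    have hle : τ + w ≤ x p := by linarith
    have hpos : 0 < τ + w := by
      have := lt_of_mk_lt_mk_of_nonneg (b := -w) (by rwa [mk_neg]) hτ0.le
      linarith
    exact ⟨hpos.trans_le hle, hmk ▸ mk_antitoneOn hpos.le (hpos.le.trans hle) hle⟩
  · simpa using hcon (Sum.inl ⟨n, s⟩)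

theorem exists_lps_of_isPerfect [∀ n, DecidableEq (S n)] (hN : 2 ≤ N)
    (G : Fin N → (∀ m, S m) → ℝ) {σ : Profile S} (hσ : IsMixed σ) (h : IsPerfect G σ) {K ℓ : ℕ}
    (hℓ : (2 * (N - 1)) ^ Fintype.card (Σ n, S n) ≤ ℓ) (hℓK : ℓ ≤ K) :
    ∃ ϱ : ∀ n, Fin (K + 1) → S n → ℝ, (IsLPSProfile ϱ ∧ FullSupport ϱ ∧ lpsLevel ϱ ≤ ℓ) ∧
      (∀ n, ϱ n 0 = σ n) ∧ ∀ n, lpsBestReply G ϱ n (σ n) K := by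
  have hℓ1 : 1 ≤ ℓ := (Nat.one_le_pow _ _ (by omega)).trans hℓ
  obtain ⟨τ, x, L, hτ0, hτ, hτL, hxL, hL, hxσ, hxτ, hdev⟩ :=
    exists_ramified_perturbation hN G h (M := K + 1) (by omega)
  obtain ⟨t, htL, ht0, ht, ⟨e, heΔ, he⟩, hval⟩ := exists_uniformizer L hτL hτ0 hτ hL
  have heℓ : e ≤ ℓ := heΔ.trans hℓ
  have he1 : 1 ≤ e := by
    rcases Nat.eq_zero_or_pos e with h0 | h0
    · rw [h0, zero_nsmul] at he
      exact absurd he hτ.ne'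
    · exact h0
  set T : Fin N → ℝ* := fun n => ∑ s : S n, x ⟨n, s⟩ with hT
  have hT1 : ∀ n, 0 < mk (T n - 1) := fun n => by
    have : T n - 1 = ∑ s : S n, (x ⟨n, s⟩ - algebraMap ℝ ℝ* (σ n s)) := by
      rw [Finset.sum_sub_distrib, ← map_sum, (hσ n).2, map_one]
    rw [this]
    exact mk_sum_pos _ fun s _ => hxσ ⟨n, s⟩
  have hTpos : ∀ n, 0 < T n := fun n => by
    have := add_pos_of_infinitesimal one_pos (hT1 n)
    rwa [map_one, add_sub_cancel] at this
  have hmkT : ∀ n, mk (T n) = 0 := fun n => by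
    have : T n = 1 + (T n - 1) := by ring
    rw [this, mk_add_eq_mk_left (by rw [mk_one]; exact hT1 n), mk_one]
  set y : (Σ n, S n) → ℝ* := fun p => (T p.1)⁻¹ * x p with hy
  have hypos : ∀ p, 0 < y p := fun p => mul_pos (inv_pos.mpr (hTpos _)) (hxτ p).1
  have hyL : ∀ p, y p ∈ L := fun p =>
    L.mul_mem (L.inv_mem (L.sum_mem fun s _ => hxL _)) (hxL p)
  have hmky : ∀ p, mk (y p) = mk (x p) := fun p => by
    rw [hy, mk_mul, mk_inv, hmkT, neg_zero, zero_add]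
  have hyσ : ∀ p, 0 < mk (y p - algebraMap ℝ ℝ* (σ p.1 p.2)) := fun p => by
    have : y p - algebraMap ℝ ℝ* (σ p.1 p.2) = (T p.1)⁻¹ * ((x p - algebraMap ℝ ℝ* (σ p.1 p.2)) -
        algebraMap ℝ ℝ* (σ p.1 p.2) * (T p.1 - 1)) := by
      have := (hTpos p.1).ne'
      simp only [hy]
      field_simp
      ring
    rw [this, mk_mul, mk_inv, hmkT, neg_zero, zero_add]
    refine (lt_min (hxσ p) ?_).trans_le (min_le_mk_sub _ _)
    exact (hT1 p.1).trans_le (mk_mul_ge_left (mk_algebraMap_real_nonneg _) le_rfl)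
  have hy0 : ∀ p, 0 ≤ mk (y p) := fun p => by
    have : y p = algebraMap ℝ ℝ* (σ p.1 p.2) + (y p - algebraMap ℝ ℝ* (σ p.1 p.2)) := by ring
    rw [this]
    exact mk_add_ge (mk_algebraMap_real_nonneg _) (hyσ p).le
  choose a ha using fun p => exists_expansion L htL ht0 ht hval (K + 1) (y p) (hyL p) (hy0 p)
  have ha0 : ∀ p, a p 0 = σ p.1 p.2 := fun p => by
    rw [← sub_eq_zero]
    by_contra hne
    have h0 := mk_algebraMap_real (K := ℝ*) hne
    have : algebraMap ℝ ℝ* (a p 0 - σ p.1 p.2) = (y p - algebraMap ℝ ℝ* (σ p.1 p.2)) -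
        ((y p - ∑ k ∈ Finset.range (K + 1), algebraMap ℝ ℝ* (a p k) * t ^ k) +
          ∑ k ∈ Finset.range K, algebraMap ℝ ℝ* (a p (k + 1)) * t ^ (k + 1)) := by
      rw [Finset.sum_range_succ', map_sub]
      ring
    rw [this] at h0
    refine absurd h0 (lt_of_lt_of_le (lt_min (hyσ p) ?_) (min_le_mk_sub _ _)).ne'
    refine lt_of_lt_of_le (lt_min ?_ (mk_sum_pos _ fun k _ => ?_)) (min_le_mk_add _ _)
    · refine ht.trans_le (le_trans ?_ (ha p))
      simpa using nsmul_le_nsmul_left ht.le (show 1 ≤ K + 1 by omega)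
    · refine ht.trans_le (mk_mul_ge_left (mk_algebraMap_real_nonneg _) ?_)
      rw [mk_pow]
      simpa using nsmul_le_nsmul_left ht.le (show 1 ≤ k + 1 by omega)
  have hsum : ∀ n, ∀ k < K + 1, ∑ s : S n, a ⟨n, s⟩ k = if k = 0 then 1 else 0 := by
    intro n k hk
    rw [← sub_eq_zero]
    refine coeff_eq_zero_of_mk_ge ht0.ne' ht (n := K + 1)
      (c := fun k => ∑ s : S n, a ⟨n, s⟩ k - if k = 0 then 1 else 0) ?_ k hk
    have hys : ∑ s : S n, y ⟨n, s⟩ = 1 := by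
      simp only [hy]
      rw [← Finset.mul_sum]
      exact inv_mul_cancel₀ (hTpos n).ne'
    have : ∑ k ∈ Finset.range (K + 1),
        algebraMap ℝ ℝ* (∑ s : S n, a ⟨n, s⟩ k - if k = 0 then 1 else 0) * t ^ k =
        -∑ s : S n, (y ⟨n, s⟩ -
          ∑ k ∈ Finset.range (K + 1), algebraMap ℝ ℝ* (a ⟨n, s⟩ k) * t ^ k) := by
      rw [Finset.sum_sub_distrib, hys, Finset.sum_comm, neg_sub]
      simp only [map_sub, sub_mul, Finset.sum_sub_distrib, map_sum, Finset.sum_mul]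
      congr 1
      rw [Finset.sum_range_succ', Finset.sum_eq_zero (fun k _ => by simp)]
      simp
    rw [this, mk_neg]
    exact mk_sum_ge _ fun s _ => ha ⟨n, s⟩
  obtain ⟨ϱ, u, hϱ, hfull, hlevel, hϱ0, hu0, hut, hzy⟩ := exists_lps_of_expansion ht0 hℓK ha hsum
    fun p => (exists_first_coeff_pos ht0 ht (show e < K + 1 by omega) (hypos p).le
      (by rw [hmky, ← he]; exact (hxτ p).2) (ha p)).imp fun q hq => ⟨hq.1.trans heℓ, hq.2⟩
  refine ⟨ϱ, ⟨hϱ, hfull, hlevel⟩, fun n => funext fun s => (hϱ0 n s).trans (ha0 ⟨n, s⟩),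
    fun n => lpsBestReply_of_approx hN G hϱ hu0 (hut ▸ ht) hy0 (by rwa [hut]) n _ fun s => ?_⟩
  obtain ⟨v, hv, hvle⟩ := hdev n s
  have hinv : 0 < ∏ m : {m : Fin N // m ≠ n}, (T m.val)⁻¹ :=
    Finset.prod_pos fun m _ => inv_pos.mpr (hTpos _)
  refine ⟨(∏ m : {m : Fin N // m ≠ n}, (T m.val)⁻¹) * v, ?_, ?_⟩
  · refine mk_mul_ge_left ?_ (le_trans ?_ hv)
    · refine Finset.prod_induction _ (fun z => 0 ≤ mk z) (fun a b ha hb => ?_) (by simp) fun m _ => ?_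
      · exact mk_mul_ge_left ha hb
      · rw [mk_inv, hmkT, neg_zero]
    · rw [hut, he, smul_smul]
      exact nsmul_le_nsmul_left ht.le (Nat.le_mul_of_pos_right _ he1)
  · rw [hy, aeval_replyPoly_smul G n _ x fun m => (T m)⁻¹]
    exact mul_le_mul_of_nonneg_left hvle hinv.le

end Forward

section Backward

open ArchimedeanClass

theorem stdPart_aeval {ι F : Type*} [Field F] [LinearOrder F] [IsStrictOrderedRing F]
    [Algebra ℝ F] {x : ι → F} (hx : ∀ i, 0 ≤ mk (x i)) (p : MvPolynomial ι ℝ) :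
    stdPart (MvPolynomial.aeval x p) = MvPolynomial.eval (fun i => stdPart (x i)) p := by
  induction p using MvPolynomial.induction_on with
  | C a =>
    rw [MvPolynomial.aeval_C, MvPolynomial.eval_C]
    exact stdPart_map_real (realHom F) a
  | add p q hp hq =>
    rw [map_add, map_add, stdPart_add (mk_aeval_nonneg p hx) (mk_aeval_nonneg q hx), hp, hq]
  | mul_X p i hp =>
    rw [map_mul, map_mul, MvPolynomial.aeval_X, MvPolynomial.eval_X,
      stdPart_mul (mk_aeval_nonneg p hx) (hx i), hp]

variable {S : Fin N → Type} [∀ n, Fintype (S n)]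

theorem exists_le_lpsLevel_pos {K ℓ : ℕ} {ϱ : ∀ n, Fin (K + 1) → S n → ℝ} (hϱ : IsLPSProfile ϱ)
    (hfull : FullSupport ϱ) (hℓ : lpsLevel ϱ ≤ ℓ) (n : Fin N) (s : S n) :
    ∃ i : Fin (K + 1), (i : ℕ) ≤ ℓ ∧ 0 < ϱ n i s := by
  have hne : {k : ℕ | ∀ s : S n, ∃ i : Fin (K + 1), (i : ℕ) ≤ k ∧ ϱ n i s ≠ 0}.Nonempty :=
    ⟨K, fun s => (hfull n s).imp fun i hi => ⟨Nat.lt_succ_iff.mp i.2, hi⟩⟩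
  obtain ⟨i, hi, hi0⟩ := Nat.sInf_mem hne s
  exact ⟨i, hi.trans ((Finset.le_sup (f := fun n => sInf {k : ℕ | ∀ s : S n, ∃ i : Fin (K + 1),
    (i : ℕ) ≤ k ∧ ϱ n i s ≠ 0}) (Finset.mem_univ n)).trans hℓ), ((hϱ n i).1 s).lt_of_ne' hi0⟩

theorem exists_common_lower_bound {P F : Type*} [Finite P] [Field F] [LinearOrder F]
    [IsStrictOrderedRing F] {x : P → F} {c : ArchimedeanClass F} (hc : 0 ≤ c) (hx : ∀ p, 0 < x p)
    (hxc : ∀ p, mk (x p) ≤ c) : ∃ T : F, 0 < T ∧ T ≤ 1 ∧ mk T ≤ c ∧ ∀ p, T ≤ x p := by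
  obtain ⟨q, hq⟩ := Finite.exists_min (fun q : Option P => q.elim 1 x)
  refine ⟨q.elim 1 x, ?_, hq none, ?_, fun p => hq (some p)⟩
  · cases q
    exacts [one_pos, hx _]
  · cases q
    exacts [by simpa using hc, hxc _]

/-- Near a strategy profile supported by an LPS profile there are positive real points satisfying
all the best-reply inequalities. -/
theorem exists_positive_point [∀ n, DecidableEq (S n)] (hN : 2 ≤ N)
    (G : Fin N → (∀ m, S m) → ℝ) {σ : Profile S} {K ℓ : ℕ}
    (hℓK : (2 * (N - 1)) ^ (Fintype.card (Σ n, S n) + 1) * ℓ ≤ K)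
    {ϱ : ∀ n, Fin (K + 1) → S n → ℝ} (hϱ : IsLPSProfile ϱ) (hfull : FullSupport ϱ)
    (hℓ : lpsLevel ϱ ≤ ℓ) (hϱσ : ∀ n, ϱ n 0 = σ n) (hbest : ∀ n, lpsBestReply G ϱ n (σ n) K)
    {r : ℝ} (hr : 0 < r) :
    ∃ ξ : (Σ n, S n) → ℝ, (∀ p, 0 < ξ p ∧ |ξ p - σ p.1 p.2| ≤ r) ∧
      ∀ n s, 0 ≤ MvPolynomial.eval ξ (replyPoly G n (σ n - pureStrat s)) := by
  obtain ⟨t, ht0, ht⟩ := exists_hyperreal_infinitesimal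
  have hℓK' : ℓ ≤ K := le_trans (Nat.le_mul_of_pos_left _ (Nat.pos_of_ne_zero
    (pow_ne_zero _ (by omega)))) hℓK
  set x₀ : (Σ n, S n) → ℝ* := fun p => ∑ k, algebraMap ℝ ℝ* (ϱ p.1 k p.2) * t ^ (k : ℕ) with hx₀
  have hterm : ∀ (p : Σ n, S n) (k : Fin (K + 1)),
      0 ≤ algebraMap ℝ ℝ* (ϱ p.1 k p.2) * t ^ (k : ℕ) := fun p k =>
    mul_nonneg (by simpa using algebraMap_le_algebraMap_real (K := ℝ*) ((hϱ p.1 k).1 p.2))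
      (pow_nonneg ht0.le _)
  have hlow : ∀ p, 0 < x₀ p ∧ mk (x₀ p) ≤ ℓ • mk t := fun p => by
    obtain ⟨i, hi, hpos⟩ := exists_le_lpsLevel_pos hϱ hfull hℓ p.1 p.2
    have h1 : 0 < algebraMap ℝ ℝ* (ϱ p.1 i p.2) * t ^ (i : ℕ) :=
      mul_pos (algebraMap_pos_real hpos) (pow_pos ht0 _)
    have h2 : algebraMap ℝ ℝ* (ϱ p.1 i p.2) * t ^ (i : ℕ) ≤ x₀ p :=
      Finset.single_le_sum (f := fun k : Fin (K + 1) =>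
        algebraMap ℝ ℝ* (ϱ p.1 k p.2) * t ^ (k : ℕ)) (fun k _ => hterm p k) (Finset.mem_univ i)
    refine ⟨h1.trans_le h2, (mk_antitoneOn h1.le (h1.le.trans h2) h2).trans ?_⟩
    rw [mk_mul, mk_algebraMap_real hpos.ne', zero_add, mk_pow]
    exact nsmul_le_nsmul_left ht.le hi
  have hnear : ∀ p, 0 < mk (x₀ p - algebraMap ℝ ℝ* (σ p.1 p.2)) := fun p => by
    simp only [hx₀]
    rw [Fin.sum_univ_succ, hϱσ, Fin.val_zero, pow_zero, mul_one, add_sub_cancel_left]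
    refine mk_sum_pos _ fun k _ => ht.trans_le (mk_mul_ge_left (mk_algebraMap_real_nonneg _) ?_)
    rw [mk_pow]
    simpa using nsmul_le_nsmul_left ht.le (show 1 ≤ (k.succ : ℕ) by simp)
  obtain ⟨T₀, hT₀pos, hT₀1, hT₀ℓ, hT₀x⟩ := exists_common_lower_bound (nsmul_nonneg ht.le ℓ)
    (fun p => (hlow p).1) fun p => (hlow p).2
  set τ := t ^ (K + 1) with hτdef
  have hτ0 : 0 < τ := pow_pos ht0 _
  have hmkτ : mk τ = (K + 1) • mk t := mk_pow _ _
  have hℓτ : ℓ • mk t < mk τ := by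
    rw [hmkτ]
    refine not_le.mp fun h => ?_
    have := (nsmul_mk_le_iff ht0.ne' ht).mp h
    omega
  have hτ : 0 < mk τ := (nsmul_nonneg ht.le ℓ).trans_lt hℓτ
  have hdev : ∀ q : Σ n, S n, ∃ C : ℕ, 0 ≤
      MvPolynomial.aeval x₀ (replyPoly G q.1 (σ q.1 - pureStrat q.2)) + (C : ℝ) • τ := by
    intro q
    have hlex := (lpsBestReply_iff hN G hϱ q.1 (σ q.1)).mp (hbest q.1) q.2
    have hKle : K + 1 ≤ (N - 1) * K + 1 := by
      have : 1 ≤ N - 1 := by omega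
      nlinarith
    obtain ⟨m, hm⟩ := Nat.exists_eq_add_of_le hKle
    rw [hx₀, aeval_replyPoly_lps, hm, Finset.sum_range_add]
    have hnn := sum_pow_nonneg_of_lex ht0 ht hlex
    set tail := ∑ j ∈ Finset.range m, algebraMap ℝ ℝ* (beliefPayoff G q.1
      (σ q.1 - pureStrat q.2) (ubelief ϱ q.1 (K + 1 + j))) * t ^ (K + 1 + j) with htail
    have hmk : mk τ ≤ mk tail := by
      refine mk_sum_ge _ fun j _ => mk_mul_ge_left (mk_algebraMap_real_nonneg _) ?_
      rw [hmkτ, mk_pow]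
      exact nsmul_le_nsmul_left ht.le (by omega)
    obtain ⟨C, hC⟩ := mk_le_mk.mp hmk
    refine ⟨C, ?_⟩
    rw [abs_of_pos hτ0, nsmul_eq_mul] at hC
    rw [Algebra.smul_def, map_natCast]
    have := neg_abs_le tail
    linarith
  choose C hC using hdev
  have hd : 1 ≤ N - 1 := by omega
  obtain ⟨x, hbox, ⟨L, -, hxL, hL⟩, hcon, v, hv, hvle⟩ := exists_bounded_ramification hd
    (g := Sum.elim (fun q : Σ n, S n =>
        MvPolynomial.rename some (replyPoly G q.1 (σ q.1 - pureStrat q.2)))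
      fun p : Σ n, S n => MvPolynomial.X (some p) - MvPolynomial.X none)
    (by
      rintro (q | p)
      · exact (MvPolynomial.totalDegree_rename_le _ _).trans (totalDegree_replyPoly_le G _ _)
      · refine (MvPolynomial.totalDegree_sub _ _).trans ?_
        simpa [MvPolynomial.totalDegree_X] using hd)
    (Sum.elim (fun q => (C q : ℝ)) fun _ => 0) (h := -MvPolynomial.X none)
    (by rw [MvPolynomial.totalDegree_neg, MvPolynomial.totalDegree_X]; omega)
    (lo := fun q => q.elim 0 fun p => σ p.1 p.2 - r)
    (hi := fun q => q.elim 1 fun p => σ p.1 p.2 + r) 1 hτ0 hτ (x₀ := fun q => q.elim T₀ x₀)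
    (by
      rintro (_ | p)
      · simpa using ⟨hT₀pos.le, hT₀1⟩
      · have h1 := add_pos_of_infinitesimal hr (hnear p)
        have h2 := add_pos_of_infinitesimal hr
          (δ := -(x₀ p - algebraMap ℝ ℝ* (σ p.1 p.2))) (by rw [mk_neg]; exact hnear p)
        simp only [Option.elim_some, map_sub, map_add]
        constructor <;> linarith)
    (by
      rintro (q | p)
      · simp only [Sum.elim_inl, MvPolynomial.aeval_rename]
        exact hC q
      · simpa using hT₀x p)
  have hx0 : ∀ q, 0 ≤ mk (x q) := fun q => mk_nonneg_of_mem_Icc (hbox q).1 (hbox q).2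
  set T := x none with hT
  have hTv : T₀ - v ≤ T := by
    simp only [map_neg, MvPolynomial.aeval_X, Option.elim_none] at hvle
    linarith
  have hT₀v : mk T₀ < mk v := by
    refine (hT₀ℓ.trans_lt hℓτ).trans_le (le_trans ?_ hv)
    simpa using nsmul_le_nsmul_left hτ.le (show 1 ≤ 2 * 1 by omega)
  have hT₀v0 : 0 < T₀ - v := by
    have := lt_of_mk_lt_mk_of_nonneg hT₀v hT₀pos.le
    linarith
  have hTpos : 0 < T := hT₀v0.trans_le hTv
  have hTℓ : mk T ≤ ℓ • mk t := by
    refine (mk_antitoneOn hT₀v0.le hTpos.le hTv).trans ?_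
    rwa [mk_sub_eq_mk_left hT₀v]
  have hmkT : mk T = 0 := by
    by_contra hne
    have hTinf : 0 < mk T := (hx0 none).lt_of_ne' hne
    obtain ⟨b, hb1, hbΔ, a, hab⟩ := hL T (hxL none) hTpos.ne'
    have ha : 1 ≤ a := by
      by_contra ha
      have h1 : a • mk τ ≤ (0 : ℤ) • mk τ := (zsmul_mk_le_iff hτ0.ne' hτ).mpr (by omega)
      rw [zero_zsmul, ← hab] at h1
      have h2 := (nsmul_mk_le_iff (m := b) (n := 0) hTpos.ne' hTinf).mp (by rwa [zero_nsmul])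
      omega
    have h1 : mk τ ≤ b • mk T := by
      rw [hab]
      simpa using (zsmul_mk_le_iff (m := 1) hτ0.ne' hτ).mpr ha
    have h2 := h1.trans (nsmul_le_nsmul_right hTℓ b)
    rw [hmkτ, smul_smul] at h2
    have h3 := (nsmul_mk_le_iff ht0.ne' ht).mp h2
    have h4 := Nat.mul_le_mul_right ℓ hbΔ
    rw [Fintype.card_option] at h4
    omega
  have hstdT : 0 < stdPart T :=
    (stdPart_nonneg hTpos.le).lt_of_ne' fun h => stdPart_eq_zero.mp h hmkT
  have hstd : ∀ (y : ℝ*) (c : ℝ), 0 ≤ mk y → (∃ v, 1 • mk τ ≤ mk v ∧ v ≤ y + c • τ) →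
      0 ≤ stdPart y := by
    rintro y c hy ⟨v, hv, hvy⟩
    rw [one_nsmul] at hv
    have h1 : 0 ≤ y + (c • τ - v) := by linarith
    have h2 : 0 < mk (c • τ - v) := by
      refine hτ.trans_le (mk_sub_ge ?_ hv)
      rw [Algebra.smul_def]
      exact mk_mul_ge_left (mk_algebraMap_real_nonneg _) le_rfl
    have := stdPart_nonneg h1
    rwa [stdPart_add_eq_left h2] at this
  refine ⟨fun p => stdPart (x (some p)), fun p => ⟨?_, ?_⟩, fun n s => ?_⟩
  · have hmk := mk_sub_ge (hx0 (some p)) (hx0 none)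
    have := hstd _ 0 hmk (by simpa using hcon (Sum.inr p))
    rw [stdPart_sub (hx0 _) (hx0 _)] at this
    linarith
  · have h1 := stdPart_le_of_le (realHom ℝ*) (hx0 (some p)) (hbox (some p)).2
    have h2 := le_stdPart_of_le (realHom ℝ*) (hx0 (some p)) (hbox (some p)).1
    simp only [Option.elim_some] at h1 h2
    rw [abs_le]
    constructor <;> linarith
  · rw [← stdPart_aeval fun p => hx0 (some p)]
    refine hstd _ (C ⟨n, s⟩) (mk_aeval_nonneg _ fun p => hx0 (some p)) ?_
    simpa [MvPolynomial.aeval_rename, Function.comp_def] using hcon (Sum.inl ⟨n, s⟩)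

theorem isPerfect_of_positive_points [∀ n, DecidableEq (S n)] [∀ n, Nonempty (S n)]
    (G : Fin N → (∀ m, S m) → ℝ) {σ : Profile S} (hσ : IsMixed σ)
    (h : ∀ r : ℝ, 0 < r → ∃ ξ : (Σ n, S n) → ℝ, (∀ p, 0 < ξ p ∧ |ξ p - σ p.1 p.2| ≤ r) ∧
      ∀ n s, 0 ≤ MvPolynomial.eval ξ (replyPoly G n (σ n - pureStrat s))) :
    IsPerfect G σ := by
  choose ξ hξ hdev using fun k : ℕ => h (1 / ((k : ℝ) + 1)) Nat.one_div_pos_of_nat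
  have hpos : ∀ k n, 0 < ∑ s, ξ k ⟨n, s⟩ := fun k n =>
    Finset.sum_pos (fun s _ => (hξ k ⟨n, s⟩).1) Finset.univ_nonempty
  have hlim : ∀ p : Σ n, S n, Filter.Tendsto (fun k => ξ k p) Filter.atTop
      (nhds (σ p.1 p.2)) := fun p =>
    tendsto_iff_dist_tendsto_zero.mpr (squeeze_zero (fun _ => dist_nonneg)
      (fun k => (hξ k p).2) tendsto_one_div_add_atTop_nhds_zero_nat)
  refine ⟨fun k n s => (∑ s, ξ k ⟨n, s⟩)⁻¹ * ξ k ⟨n, s⟩, fun k => ⟨fun n => ⟨fun s => ?_, ?_⟩,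
    fun n s => ?_⟩, ?_, fun k n s => ?_⟩
  · exact (mul_pos (inv_pos.mpr (hpos k n)) (hξ k ⟨n, s⟩).1).le
  · rw [← Finset.mul_sum]
    exact inv_mul_cancel₀ (hpos k n).ne'
  · exact mul_pos (inv_pos.mpr (hpos k n)) (hξ k ⟨n, s⟩).1
  · refine tendsto_pi_nhds.mpr fun n => tendsto_pi_nhds.mpr fun s => ?_
    have h1 : Filter.Tendsto (fun k => ∑ s, ξ k ⟨n, s⟩) Filter.atTop (nhds 1) := by
      rw [← (hσ n).2]
      exact tendsto_finsetSum _ fun s _ => hlim ⟨n, s⟩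
    simpa using (h1.inv₀ one_ne_zero).mul (hlim ⟨n, s⟩)
  · rw [ge_iff_le, payoff_update, payoff_update, ← sub_nonneg, ← map_sub, ← replyPoly_sub]
    have := aeval_replyPoly_smul G n (σ n - pureStrat s) (ξ k) fun m => (∑ s, ξ k ⟨m, s⟩)⁻¹
    rw [MvPolynomial.aeval_eq_eval, MvPolynomial.aeval_eq_eval] at this
    exact this.ge.trans' (mul_nonneg
      (Finset.prod_nonneg fun m _ => (inv_pos.mpr (hpos k m.val)).le) (hdev k n s))

end Backward

/-- explicit bounds ℓ = 2d(ZD)²(1+Z) and K = ℒ·2d(ZD)²(1+Z). -/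
theorem stmt1 {N : ℕ} (hN : 2 ≤ N) (S : Fin N → Type) [∀ n, Fintype (S n)]
    [∀ n, DecidableEq (S n)] [∀ n, Nonempty (S n)]
    (G : Fin N → (∀ m, S m) → ℝ)
    (κ d Z D L : ℕ)
    (hκ : κ = ∑ n, Fintype.card (S n)) (hd : d = N - 1)
    (hZ : Z = (2*d+6)*(2*d+5)^(κ-1)) (hD : D = 5*(κ*(2*d+4)+2)*Z)
    (hL : L = d*(6*d-3)^(2*κ-1))
    (ℓ K : ℕ) (hℓ : ℓ = 2*d*(Z*D)^2*(1+Z)) (hK : K = L*(2*d*(Z*D)^2*(1+Z)))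
    (σ : Profile S) (hσ : IsMixed σ) :
    IsPerfect G σ ↔
      ∃ ϱ : ∀ n, Fin (K+1) → S n → ℝ,
        (IsLPSProfile ϱ ∧ FullSupport ϱ ∧ lpsLevel ϱ ≤ ℓ) ∧
        (∀ n, ϱ n 0 = σ n) ∧
        (∀ n, lpsBestReply G ϱ n (σ n) K) := by
  have hd1 : 1 ≤ d := by omega
  have hcard : Fintype.card (Σ n, S n) = κ := by rw [hκ, Fintype.card_sigma]
  have hκ2 : 2 ≤ κ := by
    rw [hκ]
    refine hN.trans ?_
    simpa using Finset.card_nsmul_le_sum Finset.univ (fun n => Fintype.card (S n)) 1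
      fun n _ => Fintype.card_pos
  obtain ⟨k, rfl⟩ := Nat.exists_eq_add_of_le hκ2
  have hZΔ : (2 * d) ^ (2 + k) ≤ Z := by
    have h : 2 + k - 1 = k + 1 := by omega
    rw [hZ, h, show 2 + k = (k + 1) + 1 by omega, pow_succ']
    exact Nat.mul_le_mul (by omega) (Nat.pow_le_pow_left (by omega) _)
  have hZ1 : 1 ≤ Z := (Nat.one_le_pow _ _ (by omega)).trans hZΔ
  have hD1 : 1 ≤ D := by
    rw [hD]
    exact Nat.mul_pos (by positivity) hZ1
  have hZℓ : Z ≤ ℓ := by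
    have h1 : 1 ≤ 2 * d * (Z * D) ^ 2 := Nat.mul_pos (by omega) (pow_pos (Nat.mul_pos hZ1 hD1) 2)
    rw [hℓ]
    calc Z ≤ 1 * (1 + Z) := by omega
      _ ≤ _ := Nat.mul_le_mul_right _ h1
  have hLΔ : (2 * d) ^ (2 + k + 1) ≤ L := by
    rw [hL]
    calc (2 * d) ^ (2 + k + 1) ≤ (6 * d - 3) ^ (2 + k + 1) := Nat.pow_le_pow_left (by omega) _
      _ ≤ (6 * d - 3) ^ (2 * (2 + k) - 1) := Nat.pow_le_pow_right (by omega) (by omega)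
      _ ≤ _ := Nat.le_mul_of_pos_left _ hd1
  have hKL : K = L * ℓ := by rw [hK, hℓ]
  rw [hd] at hZΔ hLΔ
  constructor
  · intro h
    refine exists_lps_of_isPerfect hN G hσ h (by rw [hcard]; exact hZΔ.trans hZℓ) ?_
    rw [hKL]
    exact Nat.le_mul_of_pos_left _ ((Nat.pow_pos (by omega)).trans_le hLΔ)
  · rintro ⟨ϱ, ⟨hϱ, hfull, hlevel⟩, hϱσ, hbest⟩
    refine isPerfect_of_positive_points G hσ fun r hr => exists_positive_point hN G ?_ hϱ hfull
      hlevel hϱσ hbest hr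
    rw [hcard, hKL]
    exact Nat.mul_le_mul_right _ hLΔ

end GamePE
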